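/- arXiv:2506.05704 — 3 statements merged into one kernel-verified Lean document; each statement's English description precedes it below -/
import Mathlib

section
/- Suppose n ≥ 6d and F ⊆ 2^[n] is a 2d-union family. Then the number of members of F of size at least d+1 is at most C(n-2, d-1). -/
open Finset

/-- The elements of `A` that are at least `m`. -/
def tail (A : Finset ℕ) (m : ℕ) : Finset ℕ := A.filter (m ≤ ·)

/-- Any two members of `F` have a union of size at most `s`. -/
def UnionBounded (s : ℕ) (F : Finset (Finset ℕ)) : Prop :=
  ∀ A ∈ F, ∀ B ∈ F, #(A ∪ B) ≤ s

/-- `F` is closed under replacing an element of a member by a smaller non-element. -/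
def IsShifted (F : Finset (Finset ℕ)) : Prop :=
  ∀ A ∈ F, ∀ i j, i < j → j ∈ A → i ∉ A → insert i (A.erase j) ∈ F

/-- The `(i, j)`-shift of a member `A` of `F`. -/
def shiftMap (i j : ℕ) (F : Finset (Finset ℕ)) (A : Finset ℕ) : Finset ℕ :=
  if j ∈ A ∧ i ∉ A ∧ insert i (A.erase j) ∉ F then insert i (A.erase j) else A

lemma mem_tail {A : Finset ℕ} {m x : ℕ} : x ∈ tail A m ↔ x ∈ A ∧ m ≤ x := by
  simp [tail]

lemma card_insert_erase {A : Finset ℕ} {i j : ℕ} (hj : j ∈ A) (hi : i ∉ A) :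
    #(insert i (A.erase j)) = #A := by
  rw [card_insert_of_notMem (fun h => hi (mem_of_mem_erase h)), card_erase_add_one hj]

lemma card_shiftMap (i j : ℕ) (F : Finset (Finset ℕ)) (A : Finset ℕ) :
    #(shiftMap i j F A) = #A := by
  unfold shiftMap
  split_ifs with h
  · exact card_insert_erase h.1 h.2.1
  · rfl

lemma insert_erase_injective {A B : Finset ℕ} {i j : ℕ} (hA : j ∈ A) (hA' : i ∉ A)
    (hB : j ∈ B) (hB' : i ∉ B) (h : insert i (A.erase j) = insert i (B.erase j)) : A = B := by
  ext x
  have hx := Finset.ext_iff.1 h x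
  simp only [mem_insert, mem_erase] at hx
  by_cases h1 : x = i
  · subst h1; simp [hA', hB']
  · by_cases h2 : x = j
    · subst h2; simp [hA, hB]
    · simpa [h1, h2] using hx

lemma shiftMap_injOn (i j : ℕ) (F : Finset (Finset ℕ)) :
    Set.InjOn (shiftMap i j F) (F : Set (Finset ℕ)) := by
  intro A hA B hB h
  rw [mem_coe] at hA hB
  unfold shiftMap at h
  split_ifs at h with h1 h2 h2
  · exact insert_erase_injective h1.1 h1.2.1 h2.1 h2.2.1 h
  · exact absurd (h ▸ hB) h1.2.2
  · exact absurd (h ▸ hA) h2.2.2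
  · exact h

lemma card_shiftMap_union_le_of_moved {s i j : ℕ} (hij : i ≠ j) {F : Finset (Finset ℕ)}
    (hF : UnionBounded s F) {A B : Finset ℕ} (hA : A ∈ F) (hB : B ∈ F) (hjA : j ∈ A)
    (hiA : i ∉ A) (hnB : ¬ (j ∈ B ∧ i ∉ B ∧ insert i (B.erase j) ∉ F)) :
    #(insert i (A.erase j) ∪ B) ≤ s := by
  have hAB := hF A hA B hB
  by_cases hiB : i ∈ B
  · refine (card_le_card ?_).trans hAB
    intro x
    simp only [mem_union, mem_insert, mem_erase]
    rintro ((rfl | h) | h) <;> tauto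
  by_cases hjB : j ∈ B
  · have hB' : insert i (B.erase j) ∈ F := by tauto
    have heq : insert i (A.erase j) ∪ B = A ∪ insert i (B.erase j) := by
      ext x
      simp only [mem_union, mem_insert, mem_erase]
      by_cases h : x = j
      · subst h; tauto
      · tauto
    rw [heq]
    exact hF A hA _ hB'
  · have heq : insert i (A.erase j) ∪ B = insert i ((A ∪ B).erase j) := by
      ext x
      simp only [mem_union, mem_insert, mem_erase]
      by_cases h : x = j
      · subst h; tauto
      · tauto
    rw [heq, card_insert_erase (by simp [hjA]) (by simp [hiA, hiB])]
    exact hAB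

lemma UnionBounded.image_shiftMap {s i j : ℕ} (hij : i ≠ j) {F : Finset (Finset ℕ)}
    (hF : UnionBounded s F) : UnionBounded s (F.image (shiftMap i j F)) := by
  intro A' hA' B' hB'
  obtain ⟨A, hA, rfl⟩ := mem_image.1 hA'
  obtain ⟨B, hB, rfl⟩ := mem_image.1 hB'
  unfold shiftMap
  split_ifs with h1 h2 h2
  · have heq : insert i (A.erase j) ∪ insert i (B.erase j) = insert i ((A ∪ B).erase j) := by
      ext x
      simp only [mem_union, mem_insert, mem_erase]
      tauto
    rw [heq, card_insert_erase (by simp [h1.1]) (by simp [h1.2.1, h2.2.1])]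
    exact hF A hA B hB
  · exact card_shiftMap_union_le_of_moved hij hF hA hB h1.1 h1.2.1 h2
  · rw [union_comm]
    exact card_shiftMap_union_le_of_moved hij hF hB hA h2.1 h2.2.1 h1
  · exact hF A hA B hB

lemma sum_insert_erase_lt {A : Finset ℕ} {i j : ℕ} (hij : i < j) (hj : j ∈ A) (hi : i ∉ A) :
    ∑ x ∈ insert i (A.erase j), x < ∑ x ∈ A, x := by
  rw [sum_insert (fun h => hi (mem_of_mem_erase h)), ← add_sum_erase A (fun x => x) hj]
  lia

/-- Every family can be shifted without changing its size, its profile or its union bound. -/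
lemma exists_isShifted (n s k : ℕ) (F : Finset (Finset ℕ)) (hn : ∀ A ∈ F, A ⊆ range n)
    (hk : ∀ A ∈ F, k ≤ #A) (hF : UnionBounded s F) :
    ∃ G : Finset (Finset ℕ), (∀ A ∈ G, A ⊆ range n) ∧ (∀ A ∈ G, k ≤ #A) ∧
      UnionBounded s G ∧ IsShifted G ∧ #G = #F := by
  induction hw : ∑ A ∈ F, ∑ x ∈ A, x using Nat.strong_induction_on generalizing F with
  | _ w ih =>
    by_cases hS : IsShifted F
    · exact ⟨F, hn, hk, hF, hS, rfl⟩
    unfold IsShifted at hS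
    push Not at hS
    obtain ⟨A, hA, i, j, hij, hj, hi, hnot⟩ := hS
    have hle : ∀ B ∈ F, ∑ x ∈ shiftMap i j F B, x ≤ ∑ x ∈ B, x := by
      intro B _
      unfold shiftMap
      split_ifs with h
      · exact (sum_insert_erase_lt hij h.1 h.2.1).le
      · exact le_rfl
    have hlt : ∑ B ∈ F.image (shiftMap i j F), ∑ x ∈ B, x < w := by
      rw [sum_image (shiftMap_injOn i j F), ← hw]
      refine sum_lt_sum hle ⟨A, hA, ?_⟩
      rw [shiftMap, if_pos ⟨hj, hi, hnot⟩]
      exact sum_insert_erase_lt hij hj hi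
    have hn' : ∀ B ∈ F.image (shiftMap i j F), B ⊆ range n := by
      intro B' hB'
      obtain ⟨B, hB, rfl⟩ := mem_image.1 hB'
      unfold shiftMap
      split_ifs with h
      · have hjn := mem_range.1 (hn B hB h.1)
        refine insert_subset (mem_range.2 (by lia)) ((erase_subset _ _).trans (hn B hB))
      · exact hn B hB
    have hk' : ∀ B ∈ F.image (shiftMap i j F), k ≤ #B := by
      intro B' hB'
      obtain ⟨B, hB, rfl⟩ := mem_image.1 hB'
      rw [card_shiftMap]
      exact hk B hB
    obtain ⟨G, h1, h2, h3, h4, h5⟩ := ih _ hlt (F.image (shiftMap i j F)) hn' hk'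
      (hF.image_shiftMap hij.ne) rfl
    exact ⟨G, h1, h2, h3, h4, h5.trans (card_image_of_injOn (shiftMap_injOn i j F))⟩

lemma card_eq_card_inter_Ico_add_card_tail {A : Finset ℕ} {a b : ℕ} (hab : a ≤ b) :
    #(tail A a) = #(A ∩ Ico a b) + #(tail A b) := by
  rw [← card_union_of_disjoint]
  · congr 1
    ext x
    simp only [mem_tail, mem_union, mem_inter, mem_Ico]
    grind
  · rw [disjoint_left]
    intro x
    simp only [mem_tail, mem_inter, mem_Ico]
    lia

lemma tail_zero (A : Finset ℕ) : tail A 0 = A := by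
  ext x; simp [mem_tail]

/-- Two members of a shifted family can be moved apart until their union is as large as the tail
sizes permit. -/
lemma IsShifted.exists_add_card_tail_le {s : ℕ} {F : Finset (Finset ℕ)} (hS : IsShifted F)
    (hF : UnionBounded s F) (A B : Finset ℕ) (hA : A ∈ F) (hB : B ∈ F) :
    ∃ m, m + #(tail A m) + #(tail B m) ≤ s := by
  induction hc : #(A ∩ B) using Nat.strong_induction_on generalizing B with
  | _ c ih =>
    by_contra! hcon
    have hAB := hF A hA B hB
    have hne : (A ∩ B).Nonempty := by
      by_contra h
      rw [not_nonempty_iff_eq_empty, ← disjoint_iff_inter_eq_empty] at h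
      have h0 := hcon 0
      rw [card_union_of_disjoint h] at hAB
      simp only [tail_zero] at h0
      lia
    obtain ⟨j, hj, hjmax⟩ := (A ∩ B).exists_max_image id hne
    rw [mem_inter] at hj
    simp only [mem_inter, id, and_imp] at hjmax
    have hdisj : Disjoint (tail A (j + 1)) (tail B (j + 1)) := by
      rw [disjoint_left]
      intro x h1 h2
      rw [mem_tail] at h1 h2
      have := hjmax x h1.1 h2.1
      lia
    have hgap : ((range j).filter (fun x => x ∉ A ∪ B)).Nonempty := by
      by_contra h
      rw [not_nonempty_iff_eq_empty, filter_eq_empty_iff] at h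
      have hsub : range (j + 1) ∪ (tail A (j + 1) ∪ tail B (j + 1)) ⊆ A ∪ B := by
        intro x hx
        simp only [mem_union, mem_tail, mem_range] at hx
        by_cases hxj : x < j
        · exact not_not.1 (h (mem_range.2 hxj))
        · by_cases hxj' : x = j
          · subst hxj'; exact mem_union_left _ hj.1
          · have : ¬ x < j + 1 := by lia
            rw [mem_union]; tauto
      have hcard := card_le_card hsub
      rw [card_union_of_disjoint, card_union_of_disjoint hdisj, card_range] at hcard
      · have := hcon (j + 1); lia
      · rw [disjoint_left]
        intro x
        simp only [mem_range, mem_union, mem_tail]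
        lia
    obtain ⟨i, hi, himax⟩ := exists_max_image _ id hgap
    simp only [mem_filter, mem_range, mem_union, not_or, id] at hi himax
    obtain ⟨hij, hiA, hiB⟩ := hi
    have hcover : ∀ x, i < x → x ≤ j → x ∈ A ∨ x ∈ B := by
      intro x h1 h2
      by_contra h
      rw [not_or] at h
      rcases h2.lt_or_eq with h2 | rfl
      · have := himax x ⟨h2, h⟩
        lia
      · exact h.1 hj.1
    have hlt : #(A ∩ insert i (B.erase j)) < c := by
      rw [← hc]
      refine card_lt_card ⟨?_, ?_⟩
      · intro x
        simp only [mem_inter, mem_insert, mem_erase]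
        rintro ⟨hx, rfl | h⟩
        · exact absurd hx hiA
        · exact ⟨hx, h.2⟩
      · intro h
        have := h (mem_inter.2 hj)
        simp only [mem_inter, mem_insert, mem_erase] at this
        rcases this.2 with h | h
        · lia
        · exact h.1 rfl
    obtain ⟨m, hm⟩ := ih _ hlt (insert i (B.erase j)) (hS B hB i j hij hj.2 hiB) rfl
    by_cases hmid : i < m ∧ m ≤ j
    · have hA1 := card_eq_card_inter_Ico_add_card_tail (A := A) (show m ≤ j + 1 by lia)
      have hB1 := card_eq_card_inter_Ico_add_card_tail (A := B) (show m ≤ j + 1 by lia)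
      have hT : (tail B m).erase j ⊆ tail (insert i (B.erase j)) m := by
        intro x
        simp only [mem_erase, mem_tail, mem_insert]
        tauto
      have hT' := card_le_card hT
      rw [card_erase_of_mem (mem_tail.2 ⟨hj.2, hmid.2⟩)] at hT'
      have hU : Ico m (j + 1) ⊆ (A ∩ Ico m (j + 1)) ∪ (B ∩ Ico m (j + 1)) := by
        intro x hx
        have hx' := mem_Ico.1 hx
        have := hcover x (by lia) (by lia)
        simp only [mem_union, mem_inter]
        tauto
      have hU' := card_le_card hU
      have hI : 0 < #((A ∩ Ico m (j + 1)) ∩ (B ∩ Ico m (j + 1))) :=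
        card_pos.2 ⟨j, by simp [hj.1, hj.2, hmid.2]⟩
      have hUI := card_union_add_card_inter (A ∩ Ico m (j + 1)) (B ∩ Ico m (j + 1))
      rw [Nat.card_Ico] at hU'
      have := hcon (j + 1)
      lia
    · have hge : #(tail B m) ≤ #(tail (insert i (B.erase j)) m) := by
        by_cases hmi : m ≤ i
        · have heq : tail (insert i (B.erase j)) m = insert i ((tail B m).erase j) := by
            ext x
            simp only [mem_erase, mem_tail, mem_insert]
            grind
          rw [heq, card_insert_erase (mem_tail.2 ⟨hj.2, by lia⟩) (by simp [mem_tail, hiB])]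
        · apply card_le_card
          intro x
          simp only [mem_erase, mem_tail, mem_insert]
          grind
      have := hcon m
      lia

lemma IsShifted.exists_card_tail_two_mul_add_le {d : ℕ} {F : Finset (Finset ℕ)}
    (hS : IsShifted F) (hF : UnionBounded (2 * d) F) {A : Finset ℕ} (hA : A ∈ F) :
    ∃ k, #(tail A (2 * k)) + k ≤ d := by
  obtain ⟨m, hm⟩ := hS.exists_add_card_tail_le hF A A hA hA
  refine ⟨(m + 1) / 2, ?_⟩
  have : #(tail A (2 * ((m + 1) / 2))) ≤ #(tail A m) := by
    apply card_le_card
    intro x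
    simp only [mem_tail]
    intro h
    exact ⟨h.1, by lia⟩
  lia

lemma mul_choose_le_choose_step {X c M t h : ℕ} (hc : c * (t + h + 1) ≤ M + 1)
    (hX : X * (M + 1).choose t ≤ (M + 1 + h).choose (t + h)) :
    X * c * M.choose t ≤ (M + 1 + h).choose (t + h + 1) := by
  have h1 := Nat.choose_succ_right_eq (M + 1 + h) (t + h)
  have h3 : M.choose t * (M + 1) = (M + 1).choose t * (M + 1 - t) := Nat.choose_mul_succ_eq M t
  refine Nat.le_of_mul_le_mul_right (c := t + h + 1) ?_ (by lia)
  rw [h1, show M + 1 + h - (t + h) = M + 1 - t by lia]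
  calc X * c * M.choose t * (t + h + 1) = X * M.choose t * (c * (t + h + 1)) := by ring
    _ ≤ X * M.choose t * (M + 1) := by gcongr
    _ = X * (M + 1).choose t * (M + 1 - t) := by rw [mul_assoc, h3, mul_assoc]
    _ ≤ _ := by gcongr

lemma five_mul_three_pow_mul_choose_le {n d k h : ℕ} (hn : 6 * d ≤ n) (hk : 2 ≤ k)
    (hkd : k ≤ d) (hh : h + 2 ≤ k) :
    5 * 3 ^ h * (n - d - k - (h + 1)).choose (d - k) ≤ (n - d - k).choose (d - k + (h + 1)) := by
  induction h with
  | zero =>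
    have := mul_choose_le_choose_step (X := 1) (c := 5) (M := n - d - k - 1) (t := d - k) (h := 0)
      (by lia) (by simp)
    rw [show n - d - k - 1 + 1 + 0 = n - d - k by lia] at this
    simpa using this
  | succ h ih =>
    have ih' := ih (by lia)
    have := mul_choose_le_choose_step (X := 5 * 3 ^ h) (c := 3) (M := n - d - k - (h + 2))
      (t := d - k) (h := h + 1) (by lia) (by
        rw [show n - d - k - (h + 2) + 1 + (h + 1) = n - d - k by lia,
          show n - d - k - (h + 2) + 1 = n - d - k - (h + 1) by lia]
        exact ih')
    rw [show n - d - k - (h + 2) + 1 + (h + 1) = n - d - k by lia] at this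
    rw [pow_succ, ← mul_assoc]
    exact this

/-- A bound for the total weight that the sets of excess `h` send to a single set. -/
def load (h : ℕ) : ℚ := if h = 1 then 3 / 5 else 4 / (5 * 3 ^ (h - 1))

lemma sum_load_le (H : ℕ) : ∑ h ∈ Icc 1 (H + 1), load h ≤ 1 - 2 / (5 * 3 ^ H) := by
  induction H with
  | zero => norm_num [load]
  | succ H ih =>
    rw [sum_Icc_succ_top (by lia)]
    have : load (H + 1 + 1) = 4 / (5 * 3 ^ (H + 1)) := by simp [load]
    rw [this]
    have h3 : (2 : ℚ) / (5 * 3 ^ H) = 6 / (5 * 3 ^ (H + 1)) := by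
      rw [pow_succ]; field_simp; norm_num
    rw [h3] at ih
    have h4 : (6 : ℚ) / (5 * 3 ^ (H + 1)) = 4 / (5 * 3 ^ (H + 1)) + 2 / (5 * 3 ^ (H + 1)) := by
      rw [← add_div]; norm_num
    linarith

lemma sum_load_le_one (H : ℕ) : ∑ h ∈ Icc 1 H, load h ≤ 1 := by
  cases H with
  | zero => simp
  | succ H =>
    have := sum_load_le H
    have : (0 : ℚ) ≤ 2 / (5 * 3 ^ H) := by positivity
    linarith

/-- `Opposes k A B` says that `B` is disjoint from `A` and fills the gaps of `A` in `[2, 2k)`. -/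
def Opposes (k : ℕ) (A B : Finset ℕ) : Prop := Disjoint A B ∧ Ico 2 (2 * k) \ A ⊆ B

lemma Opposes.sdiff_eq {k : ℕ} {A B : Finset ℕ} (h : Opposes k A B) :
    Ico 2 (2 * k) \ A = B ∩ Ico 2 (2 * k) := by
  ext x
  have h1 := @h.2 x
  have h2 : x ∈ A → x ∉ B := fun h' => disjoint_left.1 h.1 h'
  simp only [mem_sdiff, mem_inter] at h1 ⊢
  tauto

lemma Opposes.card_inter_add_card_inter {k a : ℕ} {A B : Finset ℕ} (h : Opposes k A B)
    (ha : 2 ≤ a) : #(A ∩ Ico a (2 * k)) + #(B ∩ Ico a (2 * k)) = 2 * k - a := by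
  have heq : B ∩ Ico a (2 * k) = Ico a (2 * k) \ A := by
    ext x
    have h1 := @h.2 x
    have h2 : x ∈ A → x ∉ B := fun h' => disjoint_left.1 h.1 h'
    simp only [mem_sdiff, mem_inter, mem_Ico] at h1 ⊢
    by_cases hx : a ≤ x
    · have : 2 ≤ x := ha.trans hx
      tauto
    · tauto
  rw [heq, inter_comm, card_inter_add_card_sdiff, Nat.card_Ico]

lemma choose_le_card_opposes {n d k : ℕ} {A : Finset ℕ} (hkd : k ≤ d) (hk : 1 ≤ k)
    (hn : 2 * d ≤ n) (hAn : A ⊆ range n) (ht : #(tail A (2 * k)) = d - k)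
    (hz : #(Ico 2 (2 * k) \ A) ≤ d - 1) [DecidablePred (Opposes k A)] :
    (n - d - k).choose (d - 1 - #(Ico 2 (2 * k) \ A)) ≤
      #((powersetCard (d - 1) (Ico 2 n)).filter (Opposes k A)) := by
  have hY : #(Ico (2 * k) n \ A) = n - d - k := by
    have h1 := card_inter_add_card_sdiff (Ico (2 * k) n) A
    have h2 : Ico (2 * k) n ∩ A = tail A (2 * k) := by
      ext x
      have := @hAn x
      simp only [mem_inter, mem_Ico, mem_tail, mem_range] at *
      tauto
    rw [h2, ht, Nat.card_Ico] at h1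
    lia
  have hdis : ∀ S ∈ powersetCard (d - 1 - #(Ico 2 (2 * k) \ A)) (Ico (2 * k) n \ A),
      Disjoint (Ico 2 (2 * k) \ A) S := by
    intro S hS
    rw [disjoint_left]
    intro x hx hxS
    have := (mem_powersetCard.1 hS).1 hxS
    simp only [mem_sdiff, mem_Ico] at hx this
    lia
  rw [← hY, ← card_powersetCard]
  refine card_le_card_of_injOn (fun S => (Ico 2 (2 * k) \ A) ∪ S) ?_ ?_
  · intro S hS
    have hS' := mem_powersetCard.1 hS
    simp only [coe_filter, Set.mem_ofPred_eq, mem_powersetCard]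
    refine ⟨⟨?_, ?_⟩, ?_, subset_union_left⟩
    · refine union_subset ?_ (hS'.1.trans ?_)
      · intro x; simp only [mem_sdiff, mem_Ico]; lia
      · intro x; simp only [mem_sdiff, mem_Ico]; lia
    · rw [card_union_of_disjoint (hdis S hS), hS'.2]
      lia
    · rw [disjoint_left]
      intro x hx hx'
      rcases mem_union.1 hx' with h | h
      · exact (mem_sdiff.1 h).2 hx
      · exact (mem_sdiff.1 (hS'.1 h)).2 hx
  · intro S hS S' hS' h
    dsimp only at h
    rw [← union_sdiff_cancel_left (hdis S hS), h, union_sdiff_cancel_left (hdis S' hS')]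

lemma card_le_of_opposes {n d k : ℕ} {B : Finset ℕ} {G : Finset (Finset ℕ)} (hk : 2 ≤ k)
    (hkd : k ≤ d) (hn : 2 * d ≤ n) (hB : B ∈ powersetCard (d - 1) (Ico 2 n))
    (hz : #(B ∩ Ico 2 (2 * k)) + 2 ≤ k)
    (hG : ∀ A ∈ G, A ⊆ range n ∧ d + 1 ≤ #A ∧ #(tail A (2 * k)) = d - k ∧ Opposes k A B) :
    #G ≤ (if #(B ∩ Ico 2 (2 * k)) + 2 = k then 3 else 4) *
      (n - 2 * k - (d - 1 - #(B ∩ Ico 2 (2 * k)))).choose (d - k) := by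
  have hB' := mem_powersetCard.1 hB
  set z := #(B ∩ Ico 2 (2 * k)) with hzdef
  have hY : #(Ico (2 * k) n \ B) = n - 2 * k - (d - 1 - z) := by
    have h1 := card_sdiff_add_card_inter (Ico (2 * k) n) B
    have h2 : #(B ∩ Ico 2 (2 * k)) + #(Ico (2 * k) n ∩ B) = #B := by
      rw [← card_union_of_disjoint]
      · congr 1
        ext x
        have := @hB'.1 x
        simp only [mem_union, mem_inter, mem_Ico] at *
        grind
      · rw [disjoint_left]
        intro x
        simp only [mem_inter, mem_Ico]
        lia
    rw [Nat.card_Ico] at h1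
    lia
  set P : Finset (Finset ℕ) :=
    if z + 2 = k then (range 2).powerset.erase ∅ else (range 2).powerset with hP
  have hPc : #P = if z + 2 = k then 3 else 4 := by
    rw [hP]; split_ifs <;> rfl
  rw [← hPc, ← hY, ← card_powersetCard, ← card_product]
  refine card_le_card_of_injOn (fun A => (A ∩ range 2, tail A (2 * k))) ?_ ?_
  · intro A hA
    obtain ⟨hAn, hAc, hAt, hAB⟩ := hG A hA
    have hsplit := card_eq_card_inter_Ico_add_card_tail (A := A) (show 2 ≤ 2 * k by lia)
    have hsplit0 := card_eq_card_inter_Ico_add_card_tail (A := A) (show 0 ≤ 2 by lia)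
    have hc := hAB.card_inter_add_card_inter le_rfl
    rw [tail_zero, ← range_eq_Ico] at hsplit0
    simp only [coe_product, Set.mem_prod, mem_coe, mem_powersetCard]
    refine ⟨?_, ?_, hAt⟩
    · rw [hP]
      split_ifs with h
      · rw [mem_erase, mem_powerset]
        refine ⟨?_, inter_subset_right⟩
        intro h0
        rw [h0, card_empty] at hsplit0
        lia
      · exact mem_powerset.2 inter_subset_right
    · intro x hx
      rw [mem_tail] at hx
      have h1 := mem_range.1 (hAn hx.1)
      have h2 := disjoint_left.1 hAB.1 hx.1
      simp only [mem_sdiff, mem_Ico]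
      tauto
  · intro A hA A' hA' h
    simp only [Prod.mk.injEq] at h
    have e1 := (hG A hA).2.2.2.sdiff_eq.trans (hG A' hA').2.2.2.sdiff_eq.symm
    ext x
    have h1 := Finset.ext_iff.1 h.1 x
    have h2 := Finset.ext_iff.1 h.2 x
    have h3 := Finset.ext_iff.1 e1 x
    simp only [mem_inter, mem_range, mem_tail, mem_sdiff, mem_Ico] at h1 h2 h3
    by_cases c1 : x < 2
    · tauto
    · by_cases c2 : x < 2 * k
      · have c3 : 2 ≤ x := by lia
        simp only [c2, c3, true_and] at h3
        exact not_iff_not.1 h3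
      · have c3 : 2 * k ≤ x := by lia
        simpa only [c3, and_true] using h2

lemma card_mul_inv_choose_le_load {n d k : ℕ} {B : Finset ℕ} {G : Finset (Finset ℕ)}
    (hk : 2 ≤ k) (hkd : k ≤ d) (hn : 6 * d ≤ n) (hB : B ∈ powersetCard (d - 1) (Ico 2 n))
    (hz : #(B ∩ Ico 2 (2 * k)) + 2 ≤ k)
    (hG : ∀ A ∈ G, A ⊆ range n ∧ d + 1 ≤ #A ∧ #(tail A (2 * k)) = d - k ∧ Opposes k A B) :
    (#G : ℚ) * (((n - d - k).choose (d - 1 - #(B ∩ Ico 2 (2 * k))) : ℕ) : ℚ)⁻¹ ≤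
      load (k - 1 - #(B ∩ Ico 2 (2 * k))) := by
  have hcard := card_le_of_opposes hk hkd (by lia) hB hz hG
  set z := #(B ∩ Ico 2 (2 * k))
  obtain ⟨h, hh⟩ : ∃ h, k = z + 2 + h := ⟨k - z - 2, by lia⟩
  have hch := five_mul_three_pow_mul_choose_le (h := h) hn hk hkd (by lia)
  rw [show d - k + (h + 1) = d - 1 - z by lia] at hch
  rw [show n - 2 * k - (d - 1 - z) = n - d - k - (h + 1) by lia] at hcard
  have hpos : 0 < (n - d - k).choose (d - 1 - z) := Nat.choose_pos (by lia)
  have hposQ : (0 : ℚ) < ((n - d - k).choose (d - 1 - z) : ℕ) := by exact_mod_cast hpos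
  rw [← div_eq_mul_inv, div_le_iff₀ hposQ]
  have hchQ : (5 * 3 ^ h * ((n - d - k - (h + 1)).choose (d - k) : ℕ) : ℚ) ≤
    ((n - d - k).choose (d - 1 - z) : ℕ) := by exact_mod_cast hch
  have hcardQ : (#G : ℚ) ≤ (5 * 3 ^ h * load (k - 1 - z)) *
      ((n - d - k - (h + 1)).choose (d - k) : ℕ) := by
    have e : (5 * 3 ^ h * load (k - 1 - z) : ℚ) = ((if z + 2 = k then 3 else 4 : ℕ) : ℚ) := by
      rw [show k - 1 - z = h + 1 by lia]
      unfold load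
      by_cases h0 : h = 0
      · subst h0
        rw [if_pos (by lia), if_pos (by lia)]; norm_num
      · rw [if_neg (by lia), if_neg (by lia), Nat.add_sub_cancel]
        field_simp
        norm_num
    rw [e]
    exact_mod_cast hcard
  have hl : 0 ≤ load (k - 1 - z) := by unfold load; split_ifs <;> positivity
  nlinarith [mul_le_mul_of_nonneg_left hchQ hl]

/-- The numerical data of a first passage of the tail sizes below the line `d - k`. -/
def FirstPassage (d k : ℕ) (A : Finset ℕ) : Prop :=
  #(tail A (2 * k)) + k ≤ d ∧ ∀ k' < k, d < #(tail A (2 * k')) + k'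

lemma FirstPassage.card_tail_eq {d k : ℕ} {A : Finset ℕ} (h : FirstPassage d k A) (hk : 1 ≤ k) :
    #(tail A (2 * k)) = d - k := by
  have h1 := h.2 (k - 1) (by lia)
  have h2 := card_eq_card_inter_Ico_add_card_tail (A := A) (show 2 * (k - 1) ≤ 2 * k by lia)
  have h3 : #(A ∩ Ico (2 * (k - 1)) (2 * k)) ≤ 2 := by
    refine (card_le_card inter_subset_right).trans ?_
    rw [Nat.card_Ico]; lia
  have := h.1
  lia

lemma FirstPassage.excess_lt {d k k' : ℕ} {A B : Finset ℕ} (h : FirstPassage d k A)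
    (hAB : Opposes k A B) (hk' : 1 ≤ k') (hlt : k' < k) :
    #(B ∩ Ico 2 (2 * k)) + k' < #(B ∩ Ico 2 (2 * k')) + k := by
  have h1 := h.2 k' hlt
  have h2 := card_eq_card_inter_Ico_add_card_tail (A := A) (show 2 * k' ≤ 2 * k by lia)
  have h3 := hAB.card_inter_add_card_inter (a := 2 * k') (by lia)
  have h4 : #(B ∩ Ico 2 (2 * k)) ≤ #(B ∩ Ico 2 (2 * k')) + #(B ∩ Ico (2 * k') (2 * k)) := by
    refine (card_le_card ?_).trans (card_union_le _ _)
    intro x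
    simp only [mem_union, mem_inter, mem_Ico]
    grind
  have := h.1
  lia

lemma FirstPassage.excess_pos {d k : ℕ} {A B : Finset ℕ} (h : FirstPassage d k A)
    (hAB : Opposes k A B) (hk : 2 ≤ k) : #(B ∩ Ico 2 (2 * k)) + 2 ≤ k := by
  have := h.excess_lt hAB le_rfl (by lia)
  simp at this
  lia

open Classical in
lemma sum_inv_choose_opposes_le_one {n d : ℕ} (hn : 6 * d ≤ n) {B : Finset ℕ}
    (hB : B ∈ powersetCard (d - 1) (Ico 2 n)) (κ : Finset ℕ → ℕ) (G : Finset (Finset ℕ))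
    (hG : ∀ A ∈ G, A ⊆ range n ∧ d + 1 ≤ #A ∧ 2 ≤ κ A ∧ FirstPassage d (κ A) A) :
    ∑ A ∈ G.filter (fun A => Opposes (κ A) A B),
      (((n - d - κ A).choose (d - 1 - #(Ico 2 (2 * κ A) \ A)) : ℕ) : ℚ)⁻¹ ≤ 1 := by
  set G' := G.filter (fun A => Opposes (κ A) A B) with hG'
  have hmem : ∀ A ∈ G', A ∈ G ∧ Opposes (κ A) A B := fun A hA => mem_filter.1 hA
  set e : ℕ → ℕ := fun k => k - 1 - #(B ∩ Ico 2 (2 * k)) with he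
  have hfib : ∀ k ∈ G'.image κ, ∑ A ∈ G'.filter (fun A => κ A = k),
      (((n - d - κ A).choose (d - 1 - #(Ico 2 (2 * κ A) \ A)) : ℕ) : ℚ)⁻¹ ≤ load (e k) := by
    intro k hk
    obtain ⟨A₀, hA₀, rfl⟩ := mem_image.1 hk
    obtain ⟨hA₀G, hop⟩ := hmem A₀ hA₀
    obtain ⟨-, -, hk2, hfp⟩ := hG A₀ hA₀G
    have hconst : ∀ A ∈ G'.filter (fun A => κ A = κ A₀),
        (((n - d - κ A).choose (d - 1 - #(Ico 2 (2 * κ A) \ A)) : ℕ) : ℚ)⁻¹ =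
        (((n - d - κ A₀).choose (d - 1 - #(B ∩ Ico 2 (2 * κ A₀))) : ℕ) : ℚ)⁻¹ := by
      intro A hA
      obtain ⟨hA1, hA2⟩ := mem_filter.1 hA
      rw [(hmem A hA1).2.sdiff_eq, hA2]
    rw [sum_congr rfl hconst, sum_const, nsmul_eq_mul]
    refine card_mul_inv_choose_le_load hk2 (by have := hfp.1; lia) hn hB
      (hfp.excess_pos hop hk2) ?_
    intro A hA
    obtain ⟨hA1, hA2⟩ := mem_filter.1 hA
    obtain ⟨hAG, hopA⟩ := hmem A hA1
    obtain ⟨h1, h2, h3, h4⟩ := hG A hAG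
    rw [hA2] at hopA h3 h4
    exact ⟨h1, h2, h4.card_tail_eq (by lia), hopA⟩
  have hinj : Set.InjOn e (G'.image κ : Set ℕ) := by
    have hlt : ∀ A ∈ G', ∀ A' ∈ G', κ A' < κ A → e (κ A') < e (κ A) := by
      intro A hA A' hA' h
      obtain ⟨hAG, hop⟩ := hmem A hA
      obtain ⟨hAG', hop'⟩ := hmem A' hA'
      obtain ⟨-, -, h3, h4⟩ := hG A hAG
      obtain ⟨-, -, h3', h4'⟩ := hG A' hAG'
      have := h4.excess_lt hop (by lia) h
      have := h4.excess_pos hop h3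
      have := h4'.excess_pos hop' h3'
      simp only [he]
      lia
    intro k hk k' hk' h
    obtain ⟨A, hA, rfl⟩ := mem_image.1 (mem_coe.1 hk)
    obtain ⟨A', hA', rfl⟩ := mem_image.1 (mem_coe.1 hk')
    rcases lt_trichotomy (κ A) (κ A') with hl | hl | hl
    · exact absurd h (hlt A' hA' A hA hl).ne
    · exact hl
    · exact absurd h (hlt A hA A' hA' hl).ne'
  calc _ = ∑ k ∈ G'.image κ, ∑ A ∈ G'.filter (fun A => κ A = k),
        (((n - d - κ A).choose (d - 1 - #(Ico 2 (2 * κ A) \ A)) : ℕ) : ℚ)⁻¹ :=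
        (sum_fiberwise_of_maps_to (fun A hA => mem_image_of_mem κ hA) _).symm
    _ ≤ ∑ k ∈ G'.image κ, load (e k) := sum_le_sum hfib
    _ = ∑ h ∈ (G'.image κ).image e, load h := (sum_image hinj).symm
    _ ≤ ∑ h ∈ Icc 1 d, load h := by
        refine sum_le_sum_of_subset_of_nonneg ?_ ?_
        · intro h hh
          obtain ⟨k, hk, rfl⟩ := mem_image.1 hh
          obtain ⟨A, hA, rfl⟩ := mem_image.1 hk
          obtain ⟨hAG, hop⟩ := hmem A hA
          obtain ⟨-, -, h3, h4⟩ := hG A hAG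
          have := h4.excess_pos hop h3
          have := h4.1
          simp only [he, mem_Icc]
          lia
        · intro h _ _
          unfold load
          split_ifs <;> positivity
    _ ≤ 1 := sum_load_le_one d

lemma FirstPassage.eq_union_tail {d : ℕ} {A : Finset ℕ} (h : FirstPassage d 1 A)
    (hd : 0 < d) (hA : d + 1 ≤ #A) : A = range 2 ∪ tail A 2 ∧ #(tail A 2) = d - 1 := by
  have ht : #(tail A 2) = d - 1 := h.card_tail_eq le_rfl
  have hs := card_eq_card_inter_Ico_add_card_tail (A := A) (show 0 ≤ 2 by lia)
  rw [tail_zero, ← range_eq_Ico] at hs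
  have hr : A ∩ range 2 = range 2 :=
    eq_of_subset_of_card_le inter_subset_right (by rw [card_range]; lia)
  refine ⟨?_, ht⟩
  ext x
  have hx := Finset.ext_iff.1 hr x
  simp only [mem_union, mem_inter, mem_range, mem_tail] at hx ⊢
  by_cases hx2 : x < 2
  · tauto
  · have : 2 ≤ x := by lia
    tauto

lemma two_mul_lt_card_union {d : ℕ} {A B : Finset ℕ} (hd : 0 < d) (hA : d ≤ #(tail A 2))
    (hB : #B = d - 1) (hB2 : ∀ x ∈ B, 2 ≤ x) (hAB : Disjoint A B) :
    2 * d < #(A ∪ (range 2 ∪ B)) := by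
  have h1 : range 2 ∪ (tail A 2 ∪ B) ⊆ A ∪ (range 2 ∪ B) := by
    intro x
    simp only [mem_union, mem_tail]
    tauto
  have h2 := card_le_card h1
  rw [card_union_of_disjoint, card_union_of_disjoint, card_range] at h2
  · lia
  · rw [disjoint_left]
    intro x hx
    exact disjoint_left.1 hAB (mem_tail.1 hx).1
  · rw [disjoint_left]
    intro x hx hx'
    rw [mem_range] at hx
    rcases mem_union.1 hx' with h | h
    · have := (mem_tail.1 h).2; lia
    · have := hB2 x h; lia

lemma IsShifted.card_le_choose {n d : ℕ} (hd : 0 < d) (hn : 6 * d ≤ n)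
    {F : Finset (Finset ℕ)} (hFn : ∀ A ∈ F, A ⊆ range n) (hFd : ∀ A ∈ F, d + 1 ≤ #A)
    (hU : UnionBounded (2 * d) F) (hS : IsShifted F) : #F ≤ (n - 2).choose (d - 1) := by
  classical
  have hex : ∀ A, ∃ k, A ∈ F → FirstPassage d k A := by
    intro A
    by_cases hA : A ∈ F
    · have h := hS.exists_card_tail_two_mul_add_le hU hA
      exact ⟨Nat.find h, fun _ => ⟨Nat.find_spec h, fun k' hk' => not_le.1 (Nat.find_min h hk')⟩⟩
    · exact ⟨0, fun h => absurd h hA⟩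
  choose κ hκ using hex
  have hκ1 : ∀ A ∈ F, 1 ≤ κ A := by
    intro A hA
    by_contra h
    have h0 : κ A = 0 := by lia
    have h1 := (hκ A hA).1
    rw [h0, mul_zero, tail_zero] at h1
    have := hFd A hA
    lia
  set F₁ := F.filter (fun A => κ A = 1)
  set F₂ := F.filter (fun A => ¬ κ A = 1)
  set P := powersetCard (d - 1) (Ico 2 n)
  set E := F₁.image (fun A => tail A 2)
  have hF₁ : ∀ A ∈ F₁, A = range 2 ∪ tail A 2 ∧ #(tail A 2) = d - 1 := by
    intro A hA
    obtain ⟨hA1, hA2⟩ := mem_filter.1 hA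
    have h := hκ A hA1
    rw [hA2] at h
    exact h.eq_union_tail hd (hFd A hA1)
  have hF₂ : ∀ A ∈ F₂, A ⊆ range n ∧ d + 1 ≤ #A ∧ 2 ≤ κ A ∧ FirstPassage d (κ A) A := by
    intro A hA
    obtain ⟨hA1, hA2⟩ := mem_filter.1 hA
    have := hκ1 A hA1
    exact ⟨hFn A hA1, hFd A hA1, by lia, hκ A hA1⟩
  have hE : #E = #F₁ := by
    refine card_image_of_injOn ?_
    intro A hA A' hA' h
    dsimp only at h
    rw [(hF₁ A hA).1, (hF₁ A' hA').1, h]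
  have hEP : E ⊆ P := by
    intro B hB
    obtain ⟨A, hA, rfl⟩ := mem_image.1 hB
    refine mem_powersetCard.2 ⟨?_, (hF₁ A hA).2⟩
    intro x hx
    rw [mem_tail] at hx
    have := mem_range.1 (hFn A (mem_filter.1 hA).1 hx.1)
    exact mem_Ico.2 ⟨hx.2, this⟩
  set D := P \ E
  set w : Finset ℕ → ℚ := fun A =>
    (((n - d - κ A).choose (d - 1 - #(Ico 2 (2 * κ A) \ A)) : ℕ) : ℚ)⁻¹ with hw
  have hout : ∀ A ∈ F₂, (1 : ℚ) ≤ ∑ B ∈ D, if Opposes (κ A) A B then w A else 0 := by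
    intro A hA
    obtain ⟨h1, h2, h3, h4⟩ := hF₂ A hA
    have hAF := (mem_filter.1 hA).1
    have hkd : κ A ≤ d := by have := h4.1; lia
    have hsd : #(Ico 2 (2 * κ A) \ A) + 2 ≤ κ A := by
      have hop : Opposes (κ A) A (Ico 2 (2 * κ A) \ A) := ⟨disjoint_sdiff, Subset.rfl⟩
      have := h4.excess_pos hop h3
      rwa [← hop.sdiff_eq] at this
    have hDP : D.filter (Opposes (κ A) A) = P.filter (Opposes (κ A) A) := by
      refine Subset.antisymm (filter_subset_filter _ sdiff_subset) ?_
      intro B hB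
      obtain ⟨hBP, hop⟩ := mem_filter.1 hB
      refine mem_filter.2 ⟨mem_sdiff.2 ⟨hBP, fun hBE => ?_⟩, hop⟩
      obtain ⟨A', hA', rfl⟩ := mem_image.1 hBE
      have hbd := hU A hAF A' (mem_filter.1 hA').1
      have ht := h4.2 1 (by lia)
      rw [(hF₁ A' hA').1] at hbd
      have := two_mul_lt_card_union hd (by simpa using (by lia : d ≤ #(tail A (2 * 1))))
        (hF₁ A' hA').2 (fun x hx => (mem_tail.1 hx).2) hop.1
      lia
    have hcount := choose_le_card_opposes hkd (by lia) (by lia) h1 (h4.card_tail_eq (by lia))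
      (by lia)
    have hpos : 0 < (n - d - κ A).choose (d - 1 - #(Ico 2 (2 * κ A) \ A)) :=
      Nat.choose_pos (by lia)
    rw [← sum_filter, hDP, sum_const, nsmul_eq_mul, hw]
    dsimp only
    rw [← div_eq_mul_inv, one_le_div (by exact_mod_cast hpos)]
    exact_mod_cast hcount
  have hin : ∀ B ∈ D, (∑ A ∈ F₂, if Opposes (κ A) A B then w A else 0) ≤ (1 : ℚ) := by
    intro B hB
    rw [← sum_filter]
    exact sum_inv_choose_opposes_le_one hn (mem_sdiff.1 hB).1 κ F₂ hF₂
  have hcmp : #F₂ ≤ #D := by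
    have hQ : (#F₂ : ℚ) ≤ #D := by
      calc (#F₂ : ℚ) = ∑ A ∈ F₂, (1 : ℚ) := by simp
        _ ≤ ∑ A ∈ F₂, ∑ B ∈ D, if Opposes (κ A) A B then w A else 0 := sum_le_sum hout
        _ = ∑ B ∈ D, ∑ A ∈ F₂, if Opposes (κ A) A B then w A else 0 := sum_comm
        _ ≤ ∑ B ∈ D, (1 : ℚ) := sum_le_sum hin
        _ = #D := by simp
    exact_mod_cast hQ
  have hsum : #F₁ + #F₂ = #F := card_filter_add_card_filter_not _
  have hD : #D + #E = #P := card_sdiff_add_card_eq_card hEP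
  have hPc : #P = (n - 2).choose (d - 1) := by
    rw [card_powersetCard, Nat.card_Ico]
  lia

theorem stmt_9 (n d : ℕ) (hd : 0 < d) (hn : 6 * d ≤ n)
    (F : Finset (Finset (Fin n)))
    (hU : ∀ A ∈ F, ∀ B ∈ F, (A ∪ B).card ≤ 2 * d) :
    (F.filter (fun A => d + 1 ≤ A.card)).card ≤ (n - 2).choose (d - 1) := by
  set L := (F.filter (fun A => d + 1 ≤ A.card)).map (mapEmbedding Fin.valEmbedding).toEmbedding
    with hL
  have hmem : ∀ B ∈ L, ∃ A ∈ F, d + 1 ≤ #A ∧ A.map Fin.valEmbedding = B := by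
    intro B hB
    obtain ⟨A, hA, rfl⟩ := mem_map.1 hB
    exact ⟨A, (mem_filter.1 hA).1, (mem_filter.1 hA).2, rfl⟩
  have hLn : ∀ B ∈ L, B ⊆ range n := by
    intro B hB
    obtain ⟨A, -, -, rfl⟩ := hmem B hB
    intro x hx
    obtain ⟨y, -, rfl⟩ := mem_map.1 hx
    exact mem_range.2 y.2
  have hLd : ∀ B ∈ L, d + 1 ≤ #B := by
    intro B hB
    obtain ⟨A, -, hA, rfl⟩ := hmem B hB
    rwa [card_map]
  have hLU : UnionBounded (2 * d) L := by
    intro B hB B' hB'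
    obtain ⟨A, hA, -, rfl⟩ := hmem B hB
    obtain ⟨A', hA', -, rfl⟩ := hmem B' hB'
    rw [← map_union, card_map]
    exact hU A hA A' hA'
  obtain ⟨G, h1, h2, h3, h4, h5⟩ := exists_isShifted n (2 * d) (d + 1) L hLn hLd hLU
  rw [← card_map (mapEmbedding Fin.valEmbedding).toEmbedding, ← hL, ← h5]
  exact h4.card_le_choose hd hn h1 h2 h3
end

section
/- Let n ≥ 3.5r + 1 and let F ⊆ 2^[n] be a 2r-union family. Then the number of members of F of size at least r is at most C(n, r), with equality if and only if the members of size at least r form exactly ([n] choose r). -/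
open Finset

/-- The `l`-element sets contained in some member of `G`. -/
def shadowAt {α : Type*} [DecidableEq α] (G : Finset (Finset α)) (l : ℕ) : Finset (Finset α) :=
  G.biUnion (powersetCard l)

theorem mem_shadowAt {α : Type*} [DecidableEq α] {G : Finset (Finset α)} {l : ℕ} {S : Finset α} :
    S ∈ shadowAt G l ↔ ∃ A ∈ G, S ⊆ A ∧ S.card = l := by
  simp [shadowAt, mem_powersetCard]

theorem compress_singleton {α : Type*} [DecidableEq α] {x y : α} (hxy : x ≠ y) (A : Finset α) :
    UV.compress {x} {y} A = if x ∉ A ∧ y ∈ A then insert x (A.erase y) else A := by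
  unfold UV.compress
  simp only [disjoint_singleton_left, singleton_subset_iff]
  split_ifs with h
  · ext z
    simp only [sup_eq_union, mem_sdiff, mem_union, mem_singleton, mem_insert, mem_erase]
    grind
  · rfl

theorem mem_compression_singleton {α : Type*} [DecidableEq α] {x y : α} (hxy : x ≠ y)
    {G : Finset (Finset α)} {A : Finset α} :
    A ∈ UV.compression {x} {y} G ↔
      (A ∈ G ∧ (x ∉ A → y ∈ A → insert x (A.erase y) ∈ G)) ∨
        (A ∉ G ∧ ∃ B ∈ G, x ∉ B ∧ y ∈ B ∧ A = insert x (B.erase y)) := by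
  rw [UV.mem_compression]
  simp only [compress_singleton hxy]
  grind

theorem shadowAt_compression_subset {α : Type*} [DecidableEq α] {x y : α} (hxy : x ≠ y)
    (G : Finset (Finset α)) (l : ℕ) :
    shadowAt (UV.compression {x} {y} G) l ⊆ UV.compression {x} {y} (shadowAt G l) := by
  intro T hT
  obtain ⟨A, hA, hTA, hTl⟩ := mem_shadowAt.1 hT
  have hcard : ∀ u v, u ∉ T → v ∈ T → (insert u (T.erase v)).card = l := by
    intro u v hu hv
    rw [card_insert_of_notMem (by simp [hu]), card_erase_add_one hv, hTl]
  rw [mem_compression_singleton hxy]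
  rcases (mem_compression_singleton hxy).1 hA with ⟨hAG, hc⟩ | ⟨hAG, B, hB, hxB, hyB, rfl⟩
  · refine Or.inl ⟨mem_shadowAt.2 ⟨A, hAG, hTA, hTl⟩, fun hxT hyT => ?_⟩
    by_cases hxA : x ∈ A
    · exact mem_shadowAt.2 ⟨A, hAG, by grind, hcard x y hxT hyT⟩
    · exact mem_shadowAt.2 ⟨_, hc hxA (hTA hyT), by grind, hcard x y hxT hyT⟩
  · have hyT : y ∉ T := by grind
    by_cases hTD : T ∈ shadowAt G l
    · exact Or.inl ⟨hTD, fun _ h => absurd h hyT⟩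
    · have hxT : x ∈ T := by
        by_contra hxT
        exact hTD (mem_shadowAt.2 ⟨B, hB, by grind, hTl⟩)
      refine Or.inr ⟨hTD, insert y (T.erase x),
        mem_shadowAt.2 ⟨B, hB, by grind, hcard y x hyT hxT⟩, by grind, by grind, by grind⟩

theorem card_shadowAt_compression_le {α : Type*} [DecidableEq α] {x y : α} (hxy : x ≠ y)
    (G : Finset (Finset α)) (l : ℕ) :
    (shadowAt (UV.compression {x} {y} G) l).card ≤ (shadowAt G l).card :=
  (card_le_card (shadowAt_compression_subset hxy G l)).trans_eq (UV.card_compression _ _ _)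

theorem intersecting_compression {α : Type*} [DecidableEq α] {x y : α} (hxy : x ≠ y)
    {G : Finset (Finset α)} {t : ℕ} (hG : ∀ A ∈ G, ∀ B ∈ G, t ≤ (A ∩ B).card) :
    ∀ A ∈ UV.compression {x} {y} G, ∀ B ∈ UV.compression {x} {y} G, t ≤ (A ∩ B).card := by
  have swap : ∀ A ∈ G, ∀ B ∈ G, ∀ C : Finset α, x ∉ A →
      insert x ((A ∩ B).erase y) ⊆ C → t ≤ C.card := by
    intro A hA B hB C hx hC
    have h := card_le_card hC
    rw [card_insert_of_notMem (by simp [hx])] at h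
    have := pred_card_le_card_erase (s := A ∩ B) (a := y)
    have := hG A hA B hB
    omega
  have mixed : ∀ A ∈ G, x ∉ A → y ∈ A → ∀ B ∈ G,
      (x ∉ B → y ∈ B → insert x (B.erase y) ∈ G) → t ≤ (insert x (A.erase y) ∩ B).card := by
    intro A hA hxA hyA B hB hc
    by_cases hxB : x ∈ B
    · exact swap A hA B hB _ hxA (by grind)
    · by_cases hyB : y ∈ B
      · exact (hG A hA _ (hc hxB hyB)).trans (card_le_card (by grind))
      · exact (hG A hA B hB).trans (card_le_card (by grind))
  intro A hA B hB
  rcases (mem_compression_singleton hxy).1 hA with ⟨hAG, hcA⟩ | ⟨-, A', hA', hxA, hyA, rfl⟩ <;>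
    rcases (mem_compression_singleton hxy).1 hB with ⟨hBG, hcB⟩ | ⟨-, B', hB', hxB, hyB, rfl⟩
  · exact hG A hAG B hBG
  · rw [inter_comm]
    exact mixed B' hB' hxB hyB A hAG hcA
  · exact mixed A' hA' hxA hyA B hBG hcB
  · exact swap A' hA' B' hB' _ hxA (by clear hG swap mixed hA hB; grind)

/-- A uniform `t`-intersecting family can be shifted away from an element `y` of the ground set
without changing its size and without enlarging its shadow. -/
theorem exists_shifted {α : Type*} [DecidableEq α] (V : Finset α) (y : α) (k l t : ℕ)
    (G : Finset (Finset α)) (hV : ∀ A ∈ G, A ⊆ V ∧ A.card = k)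
    (hG : ∀ A ∈ G, ∀ B ∈ G, t ≤ (A ∩ B).card) :
    ∃ H : Finset (Finset α), (∀ A ∈ H, A ⊆ V ∧ A.card = k) ∧
      (∀ A ∈ H, ∀ B ∈ H, t ≤ (A ∩ B).card) ∧ H.card = G.card ∧
      (shadowAt H l).card ≤ (shadowAt G l).card ∧
      ∀ A ∈ H, ∀ x ∈ V, x ∉ A → y ∈ A → insert x (A.erase y) ∈ H := by
  induction hN : (G.filter (y ∈ ·)).card using Nat.strong_induction_on generalizing G with
  | _ N ih =>
    by_cases hst : ∀ A ∈ G, ∀ x ∈ V, x ∉ A → y ∈ A → insert x (A.erase y) ∈ G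
    · exact ⟨G, hV, hG, rfl, le_rfl, hst⟩
    push Not at hst
    obtain ⟨A, hA, x, hx, hxA, hyA, hbad⟩ := hst
    have hxy : x ≠ y := fun h => hxA (h ▸ hyA)
    have hlt : ((UV.compression {x} {y} G).filter (y ∈ ·)).card < N := by
      rw [← hN]
      refine card_lt_card ((ssubset_iff_of_subset fun B hB => ?_).2 ⟨A, by simp [hA, hyA], ?_⟩)
      · obtain ⟨hB, hyB⟩ := mem_filter.1 hB
        rcases (mem_compression_singleton hxy).1 hB with ⟨hBG, -⟩ | ⟨-, B', -, -, -, rfl⟩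
        · exact mem_filter.2 ⟨hBG, hyB⟩
        · simp [hxy.symm] at hyB
      · simp [mem_compression_singleton hxy, hA, hxA, hyA, hbad]
    obtain ⟨H, h1, h2, h3, h4, h5⟩ := ih _ hlt (UV.compression {x} {y} G) (fun B hB => by
      rcases (mem_compression_singleton hxy).1 hB with ⟨hBG, -⟩ | ⟨-, B', hB', hxB, hyB, rfl⟩
      · exact hV B hBG
      · refine ⟨insert_subset hx ((erase_subset _ _).trans (hV B' hB').1), ?_⟩
        rw [card_insert_of_notMem (by simp [hxB]), card_erase_add_one hyB, (hV B' hB').2])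
      (intersecting_compression hxy hG) rfl
    exact ⟨H, h1, h2, h3.trans (UV.card_compression _ _ _),
      h4.trans (card_shadowAt_compression_le hxy G l), h5⟩

theorem card_mul_choose_le_shadowAt {α : Type*} [DecidableEq α] (V : Finset α) (k l : ℕ)
    (G : Finset (Finset α)) (hV : ∀ A ∈ G, A ⊆ V ∧ A.card = k) :
    G.card * k.choose l ≤ (shadowAt G l).card * (V.card - l).choose (k - l) := by
  refine card_mul_le_card_mul (fun A S => S ⊆ A) (fun A hA => ?_) (fun S hS => ?_)
  · rw [← (hV A hA).2, ← card_powersetCard]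
    refine card_le_card fun S hS => ?_
    rw [mem_powersetCard] at hS
    exact mem_bipartiteAbove _ |>.2 ⟨mem_shadowAt.2 ⟨A, hA, hS⟩, hS.1⟩
  · obtain ⟨B, hB, hSB, hSl⟩ := mem_shadowAt.1 hS
    rw [← hSl, ← card_sdiff_of_subset (hSB.trans (hV B hB).1), ← card_powersetCard]
    refine card_le_card_of_injOn (· \ S) (fun A hA => ?_) (fun A hA A' hA' h => ?_)
    · obtain ⟨hA, hSA⟩ := (mem_bipartiteBelow _).1 hA
      refine mem_coe.2 (mem_powersetCard.2 ⟨sdiff_subset_sdiff (hV A hA).1 le_rfl, ?_⟩)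
      rw [card_sdiff_of_subset hSA, (hV A hA).2]
    · have h1 := ((mem_bipartiteBelow _).1 hA).2
      have h2 := ((mem_bipartiteBelow _).1 hA').2
      rw [← sdiff_union_of_subset h1, ← sdiff_union_of_subset h2]
      exact congrArg (· ∪ S) h

/-- Passing from `(N, l)` to `(N - 2, l - 1)` only improves the ratio in
Katona's shadow theorem. -/
theorem choose_ratio_step (t m l : ℕ) (hml : m ≤ l) (hl : l ≤ t + m) :
    (t + 2 * m + 2).choose (l + 1) * (t + 2 * m).choose m ≤
      (t + 2 * m).choose l * (t + 2 * m + 2).choose (m + 1) := by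
  have key : ∀ N j, j ≤ N → (N + 2).choose (j + 1) * ((j + 1) * (N - j + 1)) =
      N.choose j * ((N + 2) * (N + 1)) := by
    intro N j hj
    have h1 := Nat.add_one_mul_choose_eq (N + 1) j
    have h2 := Nat.choose_mul_succ_eq N j
    rw [show N + 1 - j = N - j + 1 by omega] at h2
    calc _ = ((N + 2).choose (j + 1) * (j + 1)) * (N - j + 1) := by ring
      _ = (N + 2) * ((N + 1).choose j * (N - j + 1)) := by rw [← h1]; ring
      _ = _ := by rw [← h2]; ring
  have k1 := key (t + 2 * m) l (by omega)
  have k2 := key (t + 2 * m) m (by omega)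
  obtain ⟨d, rfl⟩ := Nat.exists_eq_add_of_le hml
  obtain ⟨e, rfl⟩ : ∃ e, t = d + e := ⟨t - d, by omega⟩
  rw [show d + e + 2 * m - (m + d) = e + m by omega] at k1
  rw [show d + e + 2 * m - m = d + e + m by omega] at k2
  set a := (d + e + 2 * m + 2).choose (m + d + 1)
  set b := (d + e + 2 * m).choose m
  set c := (d + e + 2 * m).choose (m + d)
  set f := (d + e + 2 * m + 2).choose (m + 1)
  have hw : (m + 1) * (d + e + m + 1) ≤ (m + d + 1) * (e + m + 1) := by nlinarith
  refine Nat.le_of_mul_le_mul_right (c := (m + d + 1) * (e + m + 1)) ?_ (by positivity)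
  calc a * b * ((m + d + 1) * (e + m + 1)) = (a * ((m + d + 1) * (e + m + 1))) * b := by ring
    _ = c * (b * ((d + e + 2 * m + 2) * (d + e + 2 * m + 1))) := by rw [k1]; ring
    _ = c * f * ((m + 1) * (d + e + m + 1)) := by rw [← k2]; ring
    _ ≤ _ := Nat.mul_le_mul_left _ hw

/-- Katona's shadow bound on a small ground set, where it follows from double counting. -/
theorem katona_shadow_of_card_le {α : Type*} [DecidableEq α] (V : Finset α) (t m l : ℕ)
    (hl : l ≤ t + m) (G : Finset (Finset α)) (hV : ∀ A ∈ G, A ⊆ V ∧ A.card = t + m)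
    (hc : V.card ≤ t + 2 * m) :
    G.card * (t + 2 * m).choose l ≤ (shadowAt G l).card * (t + 2 * m).choose m := by
  have h := card_mul_choose_le_shadowAt V (t + m) l G hV
  have h1 : (V.card - l).choose (t + m - l) ≤ (t + 2 * m - l).choose (t + m - l) :=
    Nat.choose_le_choose _ (by omega)
  have h2 := Nat.choose_mul (n := t + 2 * m) (k := t + m) (s := l) hl
  rw [← Nat.choose_symm_of_eq_add (show t + 2 * m = t + m + m by omega)]
  refine Nat.le_of_mul_le_mul_right (c := (t + m).choose l) ?_ (Nat.choose_pos hl)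
  calc G.card * (t + 2 * m).choose l * (t + m).choose l
      = (G.card * (t + m).choose l) * (t + 2 * m).choose l := by ring
    _ ≤ ((shadowAt G l).card * (t + 2 * m - l).choose (t + m - l)) * (t + 2 * m).choose l :=
        Nat.mul_le_mul_right _ (h.trans (Nat.mul_le_mul_left _ h1))
    _ = (shadowAt G l).card * ((t + 2 * m).choose l * (t + 2 * m - l).choose (t + m - l)) := by
        ring
    _ = _ := by rw [← h2]; ring

/-- The sets of `G` containing `y`, with `y` removed. -/
def linkAt {α : Type*} [DecidableEq α] (G : Finset (Finset α)) (y : α) : Finset (Finset α) :=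
  (G.filter (y ∈ ·)).image (·.erase y)

theorem mem_linkAt {α : Type*} [DecidableEq α] {G : Finset (Finset α)} {y : α} {S : Finset α} :
    S ∈ linkAt G y ↔ ∃ A ∈ G, y ∈ A ∧ A.erase y = S := by
  simp [linkAt, and_assoc]

theorem card_linkAt {α : Type*} [DecidableEq α] (G : Finset (Finset α)) (y : α) :
    (linkAt G y).card = (G.filter (y ∈ ·)).card := by
  refine card_image_of_injOn fun A hA B hB h => ?_
  have hA := (mem_filter.1 hA).2
  have hB := (mem_filter.1 hB).2
  rw [← insert_erase hA, ← insert_erase hB]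
  exact congrArg (insert y) h

theorem card_shadowAt_split {α : Type*} [DecidableEq α] (G : Finset (Finset α)) (y : α) (l : ℕ) :
    (shadowAt (G.filter (y ∉ ·)) (l + 1)).card + (shadowAt (linkAt G y) l).card ≤
      (shadowAt G (l + 1)).card := by
  have hy : ∀ S ∈ shadowAt (linkAt G y) l, y ∉ S := by
    intro S hS
    obtain ⟨B, hB, hSB, -⟩ := mem_shadowAt.1 hS
    obtain ⟨A, -, -, rfl⟩ := mem_linkAt.1 hB
    exact fun h => notMem_erase y A (hSB h)
  have hinj : Set.InjOn (insert y) (shadowAt (linkAt G y) l : Set (Finset α)) := by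
    intro S hS T hT h
    rw [← erase_insert (hy S hS), ← erase_insert (hy T hT), h]
  rw [← card_image_of_injOn hinj, ← card_union_of_disjoint]
  · refine card_le_card (union_subset (fun S hS => ?_) (fun S hS => ?_))
    · obtain ⟨A, hA, hSA, hSl⟩ := mem_shadowAt.1 hS
      exact mem_shadowAt.2 ⟨A, (mem_filter.1 hA).1, hSA, hSl⟩
    · obtain ⟨T, hT, rfl⟩ := mem_image.1 hS
      obtain ⟨B, hB, hTB, hTl⟩ := mem_shadowAt.1 hT
      obtain ⟨A, hA, hyA, rfl⟩ := mem_linkAt.1 hB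
      refine mem_shadowAt.2 ⟨A, hA, insert_subset hyA (hTB.trans (erase_subset _ _)), ?_⟩
      rw [card_insert_of_notMem (hy T hT), hTl]
  · refine disjoint_left.2 fun S hS hS' => ?_
    obtain ⟨A, hA, hSA, -⟩ := mem_shadowAt.1 hS
    obtain ⟨T, -, rfl⟩ := mem_image.1 hS'
    exact (mem_filter.1 hA).2 (hSA (mem_insert_self _ _))

/-- **Katona's intersecting shadow theorem.** -/
theorem katona_shadow {α : Type*} [DecidableEq α] (V : Finset α) (t m l : ℕ)
    (hml : m ≤ l) (hl : l ≤ t + m) (G : Finset (Finset α))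
    (hV : ∀ A ∈ G, A ⊆ V ∧ A.card = t + m)
    (hG : ∀ A ∈ G, ∀ B ∈ G, t ≤ (A ∩ B).card) :
    G.card * (t + 2 * m).choose l ≤ (shadowAt G l).card * (t + 2 * m).choose m := by
  induction V using Finset.strongInduction generalizing m l G with
  | H V ih =>
    by_cases hc : V.card ≤ t + 2 * m
    · exact katona_shadow_of_card_le V t m l hl G hV hc
    obtain ⟨y, hy⟩ : V.Nonempty := card_pos.1 (by omega)
    obtain ⟨H, hHV, hH, hcard, hsh, hst⟩ := exists_shifted V y (t + m) l t G hV hG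
    rw [← hcard]
    refine le_trans ?_ (Nat.mul_le_mul_right _ hsh)
    have h0 := ih (V.erase y) (erase_ssubset hy) m l hml hl (H.filter (y ∉ ·))
      (fun A hA => by
        rw [mem_filter] at hA
        exact ⟨subset_erase.2 ⟨(hHV A hA.1).1, hA.2⟩, (hHV A hA.1).2⟩)
      (fun A hA B hB => hH A (mem_filter.1 hA).1 B (mem_filter.1 hB).1)
    have hsplit : H.card = (H.filter (y ∉ ·)).card + (linkAt H y).card := by
      rw [card_linkAt, add_comm, card_filter_add_card_filter_not]
    have hint : ∀ S ∈ linkAt H y, ∀ T ∈ linkAt H y, t ≤ (S ∩ T).card := by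
      intro S hS T hT
      obtain ⟨A, hA, hyA, rfl⟩ := mem_linkAt.1 hS
      obtain ⟨B, hB, hyB, rfl⟩ := mem_linkAt.1 hT
      have hlt : (A ∪ B).card < V.card := by
        have := card_union_add_card_inter A B
        have := hH A hA B hB
        have := (hHV A hA).2
        have := (hHV B hB).2
        omega
      obtain ⟨x, hx, hxAB⟩ := exists_mem_notMem_of_card_lt_card hlt
      rw [mem_union, not_or] at hxAB
      refine (hH _ (hst A hA x hx hxAB.1 hyA) B hB).trans (card_le_card fun z hz => ?_)
      rw [mem_inter, mem_insert, mem_erase] at hz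
      rw [mem_inter, mem_erase, mem_erase]
      grind
    rcases (linkAt H y).eq_empty_or_nonempty with he | ⟨S, hS⟩
    · rw [hsplit, he, card_empty, add_zero]
      refine h0.trans (Nat.mul_le_mul_right _ (card_le_card fun S hS => ?_))
      obtain ⟨A, hA, hSA⟩ := mem_shadowAt.1 hS
      exact mem_shadowAt.2 ⟨A, (mem_filter.1 hA).1, hSA⟩
    have hlink : ∀ S ∈ linkAt H y, S ⊆ V.erase y ∧ S.card + 1 = t + m := by
      intro S hS
      obtain ⟨A, hA, hyA, rfl⟩ := mem_linkAt.1 hS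
      exact ⟨erase_subset_erase _ (hHV A hA).1, by rw [card_erase_add_one hyA, (hHV A hA).2]⟩
    obtain ⟨m, rfl⟩ : ∃ m', m = m' + 1 := by
      have h1 := hint S hS S hS
      have h2 := (hlink S hS).2
      rw [inter_self] at h1
      exact ⟨m - 1, by omega⟩
    obtain ⟨l, rfl⟩ : ∃ l', l = l' + 1 := ⟨l - 1, by omega⟩
    have h1 := ih (V.erase y) (erase_ssubset hy) m l (by omega) (by omega) (linkAt H y)
      (fun S hS => ⟨(hlink S hS).1, by have := (hlink S hS).2; omega⟩) hint
    have hr := choose_ratio_step t m l (by omega) (by omega)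
    rw [show t + 2 * m + 2 = t + 2 * (m + 1) by ring] at hr
    have h2 : (linkAt H y).card * (t + 2 * (m + 1)).choose (l + 1) ≤
        (shadowAt (linkAt H y) l).card * (t + 2 * (m + 1)).choose (m + 1) := by
      refine Nat.le_of_mul_le_mul_right (c := (t + 2 * m).choose m) ?_
        (Nat.choose_pos (by omega))
      calc _ = (linkAt H y).card *
            ((t + 2 * (m + 1)).choose (l + 1) * (t + 2 * m).choose m) := by ring
        _ ≤ (linkAt H y).card *
            ((t + 2 * m).choose l * (t + 2 * (m + 1)).choose (m + 1)) :=
          Nat.mul_le_mul_left _ hr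
        _ = ((linkAt H y).card * (t + 2 * m).choose l) *
            (t + 2 * (m + 1)).choose (m + 1) := by ring
        _ ≤ ((shadowAt (linkAt H y) l).card * (t + 2 * m).choose m) *
            (t + 2 * (m + 1)).choose (m + 1) := Nat.mul_le_mul_right _ h1
        _ = _ := by ring
    calc _ ≤ ((shadowAt (H.filter (y ∉ ·)) (l + 1)).card + (shadowAt (linkAt H y) l).card) *
          (t + 2 * (m + 1)).choose (m + 1) := by
          rw [hsplit, add_mul, add_mul]
          exact add_le_add h0 h2
      _ ≤ _ := Nat.mul_le_mul_right _ (card_shadowAt_split H y l)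

theorem two_pow_mul_choose_le (r Y : ℕ) (hY : 5 * r + 2 ≤ 2 * Y) (i : ℕ) (hi : i ≤ r) :
    2 ^ i * r.choose i ≤ (Y - i).choose i := by
  induction i with
  | zero => simp
  | succ i ih =>
    have ih := ih (by omega)
    obtain ⟨d, rfl⟩ : ∃ d, r = i + d + 1 := ⟨r - i - 1, by omega⟩
    obtain ⟨q, rfl⟩ : ∃ q, Y = 2 * i + q + 1 := ⟨Y - 2 * i - 1, by omega⟩
    rw [show 2 * i + q + 1 - i = (i + q) + 1 by omega] at ih
    rw [show 2 * i + q + 1 - (i + 1) = i + q by omega]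
    have h1 := Nat.choose_mul_succ_eq (i + q) i
    have h2 := Nat.choose_succ_right_eq (i + q) i
    have h3 := Nat.choose_succ_right_eq (i + d + 1) i
    rw [show i + q + 1 - i = q + 1 by omega] at h1
    rw [show i + q - i = q by omega] at h2
    rw [show i + d + 1 - i = d + 1 by omega] at h3
    have hw : 2 * (d + 1) * (i + q + 1) ≤ (q + 1) * q := by
      obtain ⟨e, he⟩ : ∃ e, 2 * q = i + 5 * d + 5 + e := ⟨2 * q - (i + 5 * d + 5), by omega⟩
      nlinarith [sq_nonneg ((i : ℤ) - d)]
    refine Nat.le_of_mul_le_mul_right (c := (i + 1) * (i + q + 1)) ?_ (by positivity)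
    calc 2 ^ (i + 1) * (i + d + 1).choose (i + 1) * ((i + 1) * (i + q + 1))
        = 2 ^ (i + 1) * ((i + d + 1).choose (i + 1) * (i + 1)) * (i + q + 1) := by ring
      _ = (2 ^ i * (i + d + 1).choose i) * (2 * (d + 1) * (i + q + 1)) := by rw [h3]; ring
      _ ≤ (i + q + 1).choose i * ((q + 1) * q) := Nat.mul_le_mul ih hw
      _ = ((i + q).choose i * q) * (i + q + 1) := by
        linear_combination q * h1.symm
      _ = _ := by rw [← h2]; ring

/-- The `r`-sets disjoint from some `(r + i)`-set of a `2r`-union family are at least `2 ^ i`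
times as many as those `(r + i)`-sets. -/
theorem two_pow_mul_card_level_le (n r i : ℕ) (hn : 7 * r + 2 ≤ 2 * n) (hi : i ≤ r)
    (G : Finset (Finset (Fin n))) (hc : ∀ A ∈ G, A.card = r + i)
    (hU : ∀ A ∈ G, ∀ B ∈ G, (A ∪ B).card ≤ 2 * r) :
    2 ^ i * G.card ≤ (shadowAt (G.image compl) r).card := by
  have hK := katona_shadow univ (n - 2 * r) (r - i) r (by omega) (by omega) (G.image compl)
    (fun A hA => by
      obtain ⟨B, hB, rfl⟩ := mem_image.1 hA
      refine ⟨subset_univ _, ?_⟩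
      rw [card_compl, Fintype.card_fin, hc B hB]
      omega)
    (fun A hA B hB => by
      obtain ⟨A, hAG, rfl⟩ := mem_image.1 hA
      obtain ⟨B, hBG, rfl⟩ := mem_image.1 hB
      have := hU A hAG B hBG
      rw [← compl_union, card_compl, Fintype.card_fin]
      omega)
  rw [card_image_of_injective _ compl_injective,
    show n - 2 * r + 2 * (r - i) = n - 2 * i by omega] at hK
  have h1 := Nat.choose_mul (n := n - 2 * i) (k := r) (s := r - i) (by omega)
  rw [Nat.choose_symm hi, show n - 2 * i - (r - i) = n - r - i by omega,
    show r - (r - i) = i by omega] at h1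
  have h2 := two_pow_mul_choose_le r (n - r) (by omega) i hi
  have h3 : 2 ^ i * (n - 2 * i).choose (r - i) ≤ (n - 2 * i).choose r := by
    refine Nat.le_of_mul_le_mul_right (c := r.choose i) ?_ (Nat.choose_pos hi)
    rw [h1]
    calc _ = (n - 2 * i).choose (r - i) * (2 ^ i * r.choose i) := by ring
      _ ≤ _ := Nat.mul_le_mul_left _ h2
  refine Nat.le_of_mul_le_mul_right (c := (n - 2 * i).choose (r - i)) ?_
    (Nat.choose_pos (by omega))
  calc _ = G.card * (2 ^ i * (n - 2 * i).choose (r - i)) := by ring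
    _ ≤ _ := (Nat.mul_le_mul_left _ h3).trans hK

theorem two_pow_mul_sum_add_le (f : ℕ → ℕ) (e m : ℕ)
    (hf : ∀ i < m, 2 ^ (i + 1) * f i ≤ e) :
    2 ^ m * ∑ i ∈ range m, f i + e ≤ 2 ^ m * e := by
  induction m with
  | zero => simp
  | succ m ih =>
    have h1 := ih fun i hi => hf i (by omega)
    have h2 := hf m (by omega)
    rw [sum_range_succ, mul_add, pow_succ] at *
    nlinarith

theorem stmt_10 (n r : ℕ) (hr : 0 < r) (hn : 7 * r + 2 ≤ 2 * n)
    (F : Finset (Finset (Fin n)))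
    (hU : ∀ A ∈ F, ∀ B ∈ F, (A ∪ B).card ≤ 2 * r) :
    (F.filter (fun A => r ≤ A.card)).card ≤ n.choose r ∧
      ((F.filter (fun A => r ≤ A.card)).card = n.choose r ↔
        F.filter (fun A => r ≤ A.card) = Finset.univ.powersetCard r) := by
  set P : Finset (Finset (Fin n)) := univ.powersetCard r with hP
  have hPc : P.card = n.choose r := by simp [hP]
  set E := P \ F with hE
  set L : ℕ → Finset (Finset (Fin n)) := fun i => F.filter (fun A => A.card = r + (i + 1)) with hL
  have hlevel : ∀ i < r, 2 ^ (i + 1) * (L i).card ≤ E.card := by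
    intro i hi
    refine (two_pow_mul_card_level_le n r (i + 1) hn (by omega) (L i)
      (fun A hA => (mem_filter.1 hA).2)
      (fun A hA B hB => hU A (mem_filter.1 hA).1 B (mem_filter.1 hB).1)).trans
      (card_le_card fun S hS => ?_)
    obtain ⟨B, hB, hSB, hSr⟩ := mem_shadowAt.1 hS
    obtain ⟨A, hA, rfl⟩ := mem_image.1 hB
    obtain ⟨hAF, hAc⟩ := mem_filter.1 hA
    refine mem_sdiff.2 ⟨mem_powersetCard.2 ⟨subset_univ _, hSr⟩, fun hSF => ?_⟩
    have h1 := hU S hSF A hAF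
    rw [card_union_of_disjoint (subset_compl_iff_disjoint_right.1 hSB)] at h1
    omega
  have hsum := two_pow_mul_sum_add_le (fun i => (L i).card) E.card r hlevel
  have hdecomp : F.filter (fun A => r ≤ A.card) ⊆ (P ∩ F) ∪ (range r).biUnion L := by
    intro A hA
    obtain ⟨hAF, hAr⟩ := mem_filter.1 hA
    have h2 := hU A hAF A hAF
    rw [union_self] at h2
    rw [mem_union, mem_inter, mem_biUnion]
    rcases hAr.eq_or_lt with h | h
    · exact Or.inl ⟨mem_powersetCard.2 ⟨subset_univ _, h.symm⟩, hAF⟩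
    · exact Or.inr ⟨A.card - r - 1, mem_range.2 (by omega), mem_filter.2 ⟨hAF, by omega⟩⟩
  have hcount : (F.filter (fun A => r ≤ A.card)).card ≤
      (P ∩ F).card + ∑ i ∈ range r, (L i).card :=
    (card_le_card hdecomp).trans ((card_union_le _ _).trans
      (Nat.add_le_add_left card_biUnion_le _))
  have hPE : E.card + (P ∩ F).card = n.choose r := by rw [← hPc, card_sdiff_add_card_inter]
  have hle : ∑ i ∈ range r, (L i).card ≤ E.card :=
    Nat.le_of_mul_le_mul_left ((Nat.le_add_right _ _).trans hsum) (by positivity)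
  refine ⟨by omega, fun h => ?_, fun h => by rw [h, hPc]⟩
  have hE0 : E.card = 0 := by
    have : ∑ i ∈ range r, (L i).card = E.card := by omega
    rw [this] at hsum
    omega
  refine (eq_of_subset_of_card_le (fun A hA => ?_) (by rw [h, hPc])).symm
  have hAF : A ∈ F := sdiff_eq_empty_iff_subset.1 (card_eq_zero.1 hE0) hA
  exact mem_filter.2 ⟨hAF, (mem_powersetCard.1 hA).2.ge⟩
end

section
/- Let F_i ⊆ ([n] choose d+1+i) for i = 1,...,d be families such that each F_i is (2i+1)-intersecting and F_i, F_j are cross (i+j+1)-intersecting for all i, j. Then for n ≥ 9d, the sum of |F_i| over 1 ≤ i ≤ d is at most C(n-3, d-1). -/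
namespace UnionBounded

open Finset

/-- A set of pairs `(E, q)`, standing for all sets that meet `range m` in `E` and have `q` further
elements, such that these sets have at least `d + 2` elements and any two of them have a union of
at most `2 * d + 1` elements. -/
def Good (d m : ℕ) (P : Finset (Finset ℕ × ℕ)) : Prop :=
  (∀ a ∈ P, a.1 ⊆ range m ∧ d + 2 ≤ #a.1 + a.2) ∧
    ∀ a ∈ P, ∀ b ∈ P, #(a.1 ∪ b.1) + a.2 + b.2 ≤ 2 * d + 1

/-- Replace `j` by `i` in `E` when this is possible. -/
def shiftSet (i j : ℕ) (E : Finset ℕ) : Finset ℕ :=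
  if j ∈ E ∧ i ∉ E then insert i (E.erase j) else E

/-- The `(i, j)`-shift of a member `a` of the family `P`. -/
def shiftIn (i j : ℕ) (P : Finset (Finset ℕ × ℕ)) (a : Finset ℕ × ℕ) : Finset ℕ × ℕ :=
  if (shiftSet i j a.1, a.2) ∈ P then a else (shiftSet i j a.1, a.2)

lemma card_shiftSet (i j : ℕ) (E : Finset ℕ) : #(shiftSet i j E) = #E := by
  unfold shiftSet
  split_ifs with h
  · rw [card_insert_of_notMem (by simp [h.2]), card_erase_add_one h.1]
  · rfl

lemma shiftSet_subset_range {i j m : ℕ} (hi : i < m) {E : Finset ℕ} (hE : E ⊆ range m) :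
    shiftSet i j E ⊆ range m := by
  unfold shiftSet
  split_ifs with h
  · exact insert_subset (by simpa using hi) ((erase_subset _ _).trans hE)
  · exact hE

lemma shiftIn_snd (i j : ℕ) (P : Finset (Finset ℕ × ℕ)) (a : Finset ℕ × ℕ) :
    (shiftIn i j P a).2 = a.2 := by
  unfold shiftIn; split_ifs <;> rfl

lemma shiftIn_injOn (i j : ℕ) (P : Finset (Finset ℕ × ℕ)) :
    Set.InjOn (shiftIn i j P) P := by
  rintro ⟨E, q⟩ hE ⟨D, r⟩ hD h
  have hE' : (E, q) ∈ P := hE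
  have hD' : (D, r) ∈ P := hD
  unfold shiftIn at h
  split_ifs at h with h1 h2 h2
  · exact h
  · rw [← h] at h2; exact absurd hE' h2
  · rw [h] at h1; exact absurd hD' h1
  · simp only [Prod.mk.injEq] at h ⊢
    obtain ⟨h, rfl⟩ := h
    refine ⟨?_, rfl⟩
    unfold shiftSet at h h1 h2
    split_ifs at h h1 h2 with h3 h4 h4
    · ext x
      have := Finset.ext_iff.1 h x
      simp only [mem_insert, mem_erase] at this
      by_cases hx : x = i
      · subst hx; simp [h3.2, h4.2]
      · by_cases hx' : x = j
        · subst hx'; simp [h3.1, h4.1]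
        · simpa [hx, hx'] using this
    all_goals first | exact absurd hE' h1 | exact absurd hD' h2

lemma card_insert_erase_union (i j : ℕ) (A B : Finset ℕ) (hj : j ∈ A) (hiB : i ∉ B) (hi : i ∉ A)
    (hjB : j ∉ B) : #(insert i (A.erase j) ∪ B) = #(A ∪ B) := by
  have : insert i (A.erase j) ∪ B = insert i ((A ∪ B).erase j) := by
    ext x
    simp only [mem_union, mem_insert, mem_erase]
    by_cases hx : x = j
    · subst hx; simp [hjB]
    · simp [hx, or_assoc]
  rw [this, card_insert_of_notMem (by simp [hi, hiB]), card_erase_add_one (by simp [hj])]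

lemma card_union_shiftIn_le (i j : ℕ) {P : Finset (Finset ℕ × ℕ)} {K : ℕ}
    (hP : ∀ a ∈ P, ∀ b ∈ P, #(a.1 ∪ b.1) + a.2 + b.2 ≤ K) {a b : Finset ℕ × ℕ}
    (ha : a ∈ P) (hb : b ∈ P) (h1 : (shiftSet i j a.1, a.2) ∉ P) :
    #(shiftSet i j a.1 ∪ (shiftIn i j P b).1) + a.2 + b.2 ≤ K := by
  have hab := hP a ha b hb
  have ha' : j ∈ a.1 ∧ i ∉ a.1 := by
    by_contra h
    exact h1 (by rw [shiftSet, if_neg h]; exact ha)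
  have hij : i ≠ j := by rintro rfl; exact ha'.2 ha'.1
  rw [shiftSet, if_pos ha']
  unfold shiftIn
  split_ifs with h2
  · unfold shiftSet at h2
    split_ifs at h2 with h3
    · have := hP a ha _ h2
      have e : insert i (a.1.erase j) ∪ b.1 = a.1 ∪ insert i (b.1.erase j) := by
        ext x
        simp only [mem_union, mem_insert, mem_erase]
        by_cases hx : x = j
        · subst hx; simp [ha'.1, h3.1]
        · simp only [ne_eq, hx, not_false_eq_true, true_and]; tauto
      rw [e]; exact this
    · by_cases hib : i ∈ b.1
      · refine le_trans ?_ hab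
        gcongr ?_ + _ + _
        apply card_le_card
        intro x
        simp only [mem_union, mem_insert, mem_erase]
        rintro ((rfl | h) | h)
        · exact Or.inr hib
        · exact Or.inl h.2
        · exact Or.inr h
      · have hjb : j ∉ b.1 := fun h => h3 ⟨h, hib⟩
        rw [card_insert_erase_union i j _ _ ha'.1 hib ha'.2 hjb]
        exact hab
  · have hb' : j ∈ b.1 ∧ i ∉ b.1 := by
      by_contra h
      exact h2 (by rw [shiftSet, if_neg h]; exact hb)
    dsimp only
    rw [shiftSet, if_pos hb']
    have e : insert i (a.1.erase j) ∪ insert i (b.1.erase j) =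
        insert i ((a.1 ∪ b.1).erase j) := by
      ext x
      simp only [mem_union, mem_insert, mem_erase]; tauto
    rw [e, card_insert_of_notMem (by simp [ha'.2, hb'.2]),
      card_erase_add_one (by simp [ha'.1])]
    exact hab

lemma Good.shift {d m i j : ℕ} (hi : i < m) {P : Finset (Finset ℕ × ℕ)} (hP : Good d m P) :
    Good d m (P.image (shiftIn i j P)) := by
  constructor
  · simp only [mem_image]
    rintro _ ⟨a, ha, rfl⟩
    have := hP.1 a ha
    rw [shiftIn_snd]
    unfold shiftIn
    split_ifs
    · exact this
    · exact ⟨shiftSet_subset_range hi this.1, by rw [card_shiftSet]; exact this.2⟩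
  · simp only [mem_image]
    rintro _ ⟨a, ha, rfl⟩ _ ⟨b, hb, rfl⟩
    rw [shiftIn_snd, shiftIn_snd]
    by_cases h1 : (shiftSet i j a.1, a.2) ∈ P
    · by_cases h2 : (shiftSet i j b.1, b.2) ∈ P
      · rw [shiftIn, if_pos h1, shiftIn, if_pos h2]
        exact hP.2 a ha b hb
      · have := card_union_shiftIn_le i j hP.2 hb ha h2
        have e : (shiftIn i j P b).1 = shiftSet i j b.1 := by rw [shiftIn, if_neg h2]
        rw [e, union_comm]
        omega
    · have := card_union_shiftIn_le i j hP.2 ha hb h1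
      have e : (shiftIn i j P a).1 = shiftSet i j a.1 := by rw [shiftIn, if_neg h1]
      rw [e]
      exact this

/-- Every pair that can be added to the family belongs to it. -/
def Saturated (d m : ℕ) (P : Finset (Finset ℕ × ℕ)) : Prop :=
  ∀ E q, E ⊆ range m → d + 2 ≤ #E + q → #E + q + q ≤ 2 * d + 1 →
    (∀ b ∈ P, #(E ∪ b.1) + q + b.2 ≤ 2 * d + 1) → (E, q) ∈ P

/-- The family is closed under replacing an element of a set by a smaller one. -/
def Shifted (m : ℕ) (P : Finset (Finset ℕ × ℕ)) : Prop :=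
  ∀ E q i j, (E, q) ∈ P → i < j → j < m → j ∈ E → i ∉ E → (insert i (E.erase j), q) ∈ P

lemma Good.subset_product {d m : ℕ} {P : Finset (Finset ℕ × ℕ)} (hP : Good d m P) :
    P ⊆ (range m).powerset ×ˢ range (2 * d + 2) := by
  intro a ha
  have h1 := hP.1 a ha
  have h2 := hP.2 a ha a ha
  simp only [mem_product, mem_powerset, mem_range]
  exact ⟨h1.1, by omega⟩

lemma Good.exists_saturated {d m : ℕ} {P : Finset (Finset ℕ × ℕ)} (hP : Good d m P) (f : ℕ → ℕ) :
    ∃ Q, Good d m Q ∧ Saturated d m Q ∧ Shifted m Q ∧ ∑ a ∈ P, f a.2 ≤ ∑ a ∈ Q, f a.2 := by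
  classical
  let pot : Finset (Finset ℕ × ℕ) → ℕ := fun Q => ∑ a ∈ Q, (1 + ∑ x ∈ a.1, (m - x))
  obtain ⟨Q, hQ, hmax⟩ := exists_max_image
    {Q ∈ ((range m).powerset ×ˢ range (2 * d + 2)).powerset |
      Good d m Q ∧ ∑ a ∈ P, f a.2 ≤ ∑ a ∈ Q, f a.2} pot
    ⟨P, by simpa using ⟨hP.subset_product, hP⟩⟩
  simp only [mem_filter, mem_powerset] at hQ hmax
  obtain ⟨-, hQ, hw⟩ := hQ
  have key : ∀ Q', Good d m Q' → ∑ a ∈ Q, f a.2 ≤ ∑ a ∈ Q', f a.2 → pot Q' ≤ pot Q :=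
    fun Q' h1 h2 => hmax Q' ⟨h1.subset_product, h1, hw.trans h2⟩
  refine ⟨Q, hQ, ?_, ?_, hw⟩
  · intro E q hE h1 h2 h3
    by_contra hn
    have := key (insert (E, q) Q) ⟨?_, ?_⟩ ?_
    · simp only [pot] at this
      rw [sum_insert hn] at this
      omega
    · intro a ha
      rcases mem_insert.1 ha with rfl | ha
      · exact ⟨hE, h1⟩
      · exact hQ.1 a ha
    · intro a ha b hb
      rcases mem_insert.1 ha with rfl | ha <;> rcases mem_insert.1 hb with rfl | hb
      · simpa using h2
      · exact h3 b hb
      · have := h3 a ha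
        rw [union_comm]
        dsimp only
        omega
      · exact hQ.2 a ha b hb
    · rw [sum_insert hn]; omega
  · intro E q i j hE hij hj hjE hiE
    by_contra hn
    have himg := key (Q.image (shiftIn i j Q)) (hQ.shift (hij.trans hj)) (by
      rw [sum_image (shiftIn_injOn i j Q)]
      simp [shiftIn_snd])
    simp only [pot] at himg
    rw [sum_image (shiftIn_injOn i j Q)] at himg
    have hs : ∀ D : Finset ℕ, j ∈ D → i ∉ D →
        ∑ x ∈ D, (m - x) < ∑ x ∈ insert i (D.erase j), (m - x) := by
      intro D hD hD'
      rw [sum_insert (by simp [hD']), ← add_sum_erase _ _ hD]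
      omega
    refine absurd himg (not_le.2 (sum_lt_sum ?_ ⟨(E, q), hE, ?_⟩))
    · intro a ha
      unfold shiftIn
      split_ifs with h1
      · exact le_rfl
      · unfold shiftSet
        dsimp only
        split_ifs with h2
        · have := hs a.1 h2.1 h2.2
          omega
        · exact le_rfl
    · have e : shiftSet i j E = insert i (E.erase j) := by rw [shiftSet, if_pos ⟨hjE, hiE⟩]
      have := hs E hjE hiE
      rw [shiftIn, if_neg (by rw [e]; exact hn)]
      dsimp only
      rw [e]
      omega

/-- A family of large subsets of `range (2 * h)` in which every member has a partner covering its
complement, such that common elements may be deleted, has a point missed by a ninth of it. -/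
lemma exists_le_nine_mul_card_filter_notMem {h : ℕ} (hh : 2 ≤ h) (R : Finset (Finset ℕ))
    (hsub : ∀ E ∈ R, E ⊆ range (2 * h) ∧ h + 1 ≤ #E)
    (hp : ∀ E ∈ R, ∃ D ∈ R, E ∪ D = range (2 * h) ∧
      (h + 2 ≤ #E → ∀ x ∈ E ∩ D, E.erase x ∈ R)) :
    ∃ x ∈ range (2 * h), #R ≤ 9 * #{E ∈ R | x ∉ E} := by
  classical
  choose! D hDR hDu hDe using hp
  set M := ∑ E ∈ R, #(range (2 * h) \ E) with hM
  have hMx : ∑ x ∈ range (2 * h), #{E ∈ R | x ∉ E} = M := by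
    rw [hM]
    simp only [card_filter, sdiff_eq_filter]
    exact sum_comm
  have hX : ∑ E ∈ R with h + 2 ≤ #E, #(E ∩ D E) ≤ M := by
    rw [hM, ← card_sigma, ← card_sigma]
    refine card_le_card_of_injOn (fun p => ⟨p.1.erase p.2, p.2⟩) ?_ ?_
    · rintro ⟨E, x⟩ hx
      simp only [coe_sigma, Set.mem_sigma_iff, mem_coe, mem_filter] at hx
      simp only [coe_sigma, Set.mem_sigma_iff, mem_coe, mem_sdiff]
      exact ⟨hDe E hx.1.1 hx.1.2 x hx.2, (hsub E hx.1.1).1 (mem_inter.1 hx.2).1, by simp⟩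
    · rintro ⟨E, x⟩ hx ⟨E', x'⟩ hx' he
      simp only [coe_sigma, Set.mem_sigma_iff, mem_coe, mem_filter, mem_inter] at hx hx'
      simp only [Sigma.mk.injEq, heq_eq_eq] at he
      obtain ⟨he, rfl⟩ := he
      have : E = E' := by rw [← insert_erase hx.2.1, he, insert_erase hx'.2.1]
      subst this
      rfl
  have hcard : ∀ E ∈ R, #(range (2 * h) \ E) + #E = 2 * h := fun E hE => by
    rw [card_sdiff_add_card_eq_card (hsub E hE).1, card_range]
  have hS : M + ∑ E ∈ R, #E = #R * (2 * h) := by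
    rw [hM, ← sum_add_distrib, sum_congr rfl hcard, sum_const, smul_eq_mul]
  have h1 : (h - 1) * #{E ∈ R | #E = h + 1} ≤ M := by
    rw [card_filter, mul_sum, hM]
    refine sum_le_sum fun E hE => ?_
    have := hcard E hE
    split_ifs <;> omega
  have h2 : (∑ E ∈ R, #E) + #R ≤
      h * #R + (∑ E ∈ R with h + 2 ≤ #E, #(E ∩ D E)) + 2 * #{E ∈ R | #E = h + 1} := by
    rw [card_filter, sum_filter, mul_sum, card_eq_sum_ones, mul_sum, ← sum_add_distrib,
      ← sum_add_distrib, ← sum_add_distrib]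
    refine sum_le_sum fun E hE => ?_
    have a1 := (hsub E hE).2
    have a2 := (hsub _ (hDR E hE)).2
    have a3 := card_union_add_card_inter E (D E)
    rw [hDu E hE, card_range] at a3
    split_ifs <;> omega
  by_contra! hcon
  have h3 : 9 * M < #R * (2 * h) := by
    rw [← hMx, mul_sum]
    calc _ < ∑ x ∈ range (2 * h), #R :=
          sum_lt_sum_of_nonempty ⟨0, by simp; omega⟩ hcon
      _ = _ := by rw [sum_const, card_range, smul_eq_mul, mul_comm]
  obtain ⟨k, rfl⟩ : ∃ k, h = k + 2 := ⟨h - 2, by omega⟩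
  set r := #R
  set r1 := #{E ∈ R | #E = k + 2 + 1}
  have e : k + 2 - 1 = k + 1 := rfl
  rw [e] at h1
  have h4 : (k + 3) * r ≤ 2 * M + 2 * r1 := by nlinarith
  have h5 : (k + 1) * ((k + 3) * r) ≤ 2 * (k + 2) * M := by nlinarith
  nlinarith [Nat.zero_le (k * r), Nat.zero_le (k * k * r)]

lemma exists_selection (R : ℕ → Finset (Finset ℕ)) (N c : ℕ) (V : Finset ℕ)
    (hmono : ∀ k ≤ c, N.choose k ≤ N.choose (k + 1))
    (hmid : ∀ k, 2 * k = c → ∃ T ⊆ R k, (∀ E ∈ T, ∀ D ∈ T, E ∪ D ≠ V) ∧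
      #(R k) * N.choose k ≤ #T * (N.choose k + N.choose (k + 1))) :
    ∃ T : ℕ → Finset (Finset ℕ), (∀ k, T k ⊆ R k) ∧ (∀ k, c < k → T k = R k) ∧
      (∀ k l, k + l = c → ∀ E ∈ T k, ∀ D ∈ T l, E ∪ D ≠ V) ∧
      ∑ k ∈ range (c + 1), #(R k) * N.choose k ≤
        ∑ k ∈ range (c + 1), #(T k) * (N.choose k + N.choose (k + 1)) := by
  classical
  choose! T₀ hT₀ hT₁ hT₂ using hmid
  let p : ℕ → Prop := fun k => #(R (c - k)) * N.choose (c - k) ≤ #(R k) * N.choose (k + 1)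
  let T : ℕ → Finset (Finset ℕ) := fun k => if 2 * k = c then T₀ k else
    if (2 * k < c ∧ p k) ∨ (c < 2 * k ∧ ¬ p (c - k)) ∨ c < k then R k else ∅
  have hsub : ∀ k, T k ⊆ R k := by
    intro k
    simp only [T]
    split_ifs with h1 h2
    · exact hT₀ k h1
    · exact Subset.rfl
    · exact empty_subset _
  refine ⟨T, hsub, ?_, ?_, ?_⟩
  · intro k hk
    simp only [T]
    rw [if_neg (by omega), if_pos (Or.inr (Or.inr hk))]
  · intro k l hkl E hE D hD
    simp only [T] at hE hD
    by_cases h : 2 * k = c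
    · obtain rfl : k = l := by omega
      rw [if_pos h] at hE hD
      exact hT₁ k h E hE D hD
    · rw [if_neg h] at hE
      rw [if_neg (by omega)] at hD
      obtain rfl : l = c - k := by omega
      have hl : c - (c - k) = k := by omega
      split_ifs at hE hD with h1 h2
      · rw [hl] at h2
        exfalso
        rcases h1 with h1 | h1 | h1 <;> rcases h2 with h2 | h2 | h2
        · omega
        · exact h2.2 h1.2
        · omega
        · exact h1.2 h2.2
        all_goals omega
      · simp at hD
      · simp at hE
      · simp at hE
  · have key : ∀ k ∈ range (c + 1), #(R k) * N.choose k ≤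
        #(T k) * N.choose k + #(T (c - k)) * N.choose (c - k + 1) := by
      intro k hk
      have hk : k ≤ c := by simpa [Nat.lt_succ_iff] using hk
      have hl : c - (c - k) = k := by omega
      rcases lt_trichotomy (2 * k) c with h | h | h
      · by_cases hpk : p k
        · have : T k = R k := by
            simp only [T]; rw [if_neg (by omega), if_pos (Or.inl ⟨h, hpk⟩)]
          rw [this]; omega
        · have : T (c - k) = R (c - k) := by
            simp only [T]
            rw [if_neg (by omega), if_pos (Or.inr (Or.inl ⟨by omega, by rwa [hl]⟩))]
          rw [this]
          have h1 := Nat.mul_le_mul_left #(R k) (hmono k hk)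
          have h2 := Nat.mul_le_mul_left #(R (c - k)) (hmono (c - k) (by omega))
          have h3 := lt_of_not_ge hpk
          omega
      · have e : c - k = k := by omega
        rw [e, ← mul_add]
        simp only [T]
        rw [if_pos h]
        exact hT₂ k h
      · by_cases hpk : p (c - k)
        · have : T (c - k) = R (c - k) := by
            simp only [T]
            rw [if_neg (by omega), if_pos (Or.inl ⟨by omega, hpk⟩)]
          rw [this]
          have : #(R (c - (c - k))) * N.choose (c - (c - k)) ≤ _ := hpk
          rw [hl] at this
          omega
        · have : T k = R k := by
            simp only [T]
            rw [if_neg (by omega), if_pos (Or.inr (Or.inl ⟨h, hpk⟩))]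
          rw [this]; omega
    refine (sum_le_sum key).trans ?_
    simp only [mul_add, sum_add_distrib]
    have := sum_range_reflect (fun k => #(T k) * N.choose (k + 1)) (c + 1)
    simp only [Nat.add_sub_cancel] at this
    rw [this]

lemma sum_snd_eq_sum_fiber {M K : ℕ} {P : Finset (Finset ℕ × ℕ)}
    (hP : P ⊆ (range M).powerset ×ˢ range K) (f : ℕ → ℕ) :
    ∑ a ∈ P, f a.2 = ∑ k ∈ range K, #{E ∈ (range M).powerset | (E, k) ∈ P} * f k := by
  classical
  have e : P = {a ∈ (range M).powerset ×ˢ range K | a ∈ P} := by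
    ext a
    simp only [mem_filter]
    exact ⟨fun h => ⟨hP h, h⟩, fun h => h.2⟩
  conv_lhs => rw [e]
  rw [sum_filter, sum_product_right]
  refine sum_congr rfl fun k _ => ?_
  rw [card_filter, sum_mul]
  exact sum_congr rfl fun E _ => by split_ifs <;> simp

lemma erase_subset_range {m : ℕ} {E : Finset ℕ} (hE : E ⊆ range (m + 1)) :
    E.erase m ⊆ range m := by
  rwa [range_add_one, subset_insert_iff] at hE

lemma card_union_insert_insert {m : ℕ} {E D : Finset ℕ} (hE : E ⊆ range m) (hD : D ⊆ range m) :
    #(insert m E ∪ insert m D) = #(E ∪ D) + 1 := by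
  have : insert m E ∪ insert m D = insert m (E ∪ D) := by
    ext; simp only [mem_union, mem_insert]; tauto
  rw [this, card_insert_of_notMem]
  intro h
  simpa using union_subset hE hD h

lemma card_union_insert_right {m : ℕ} {E D : Finset ℕ} (hE : E ⊆ range m) (hD : D ⊆ range m) :
    #(E ∪ insert m D) = #(E ∪ D) + 1 := by
  rw [union_insert, card_insert_of_notMem]
  intro h
  simpa using union_subset hE hD h

lemma Good.union_eq_range {d m k l : ℕ} {P : Finset (Finset ℕ × ℕ)} (hP : Good d (m + 1) P)
    (hs : Shifted (m + 1) P) {E D : Finset ℕ} (hE : E ⊆ range m) (hD : D ⊆ range m)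
    (hEP : (insert m E, k) ∈ P) (hDP : (insert m D, l) ∈ P) (h : 2 * d ≤ #(E ∪ D) + k + l) :
    E ∪ D = range m := by
  refine Subset.antisymm (union_subset hE hD) fun x hx => ?_
  by_contra hn
  rw [mem_union, not_or] at hn
  have hx' : x < m := mem_range.1 hx
  have hm : m ∉ E := fun h => by simpa using hE h
  have h1 := hs _ _ x m hEP hx' (by omega) (by simp) (by simp [hn.1, hx'.ne])
  rw [erase_insert hm] at h1
  have h2 := hP.2 _ h1 _ hDP
  dsimp only at h2
  rw [card_union_insert_right (insert_subset hx hE) hD, insert_union,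
    card_insert_of_notMem (by simp [hn])] at h2
  omega

lemma Good.card_union_le {d m k l : ℕ} {P : Finset (Finset ℕ × ℕ)} (hP : Good d (m + 1) P)
    {E D : Finset ℕ} (hE : E ⊆ range m) (hD : D ⊆ range m)
    (hEP : (insert m E, k) ∈ P) (hDP : (insert m D, l) ∈ P) : #(E ∪ D) + k + l ≤ 2 * d := by
  have := hP.2 _ hEP _ hDP
  dsimp only at this
  rw [card_union_insert_insert hE hD] at this
  omega

/-- The sets `E` for which `(insert m E, k)` belongs to the family but `(E, k + 1)` does not. -/
def critical (m : ℕ) (P : Finset (Finset ℕ × ℕ)) (k : ℕ) : Finset (Finset ℕ) :=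
  {E ∈ (range m).powerset | (insert m E, k) ∈ P ∧ (E, k + 1) ∉ P}

lemma mem_critical {m k : ℕ} {P : Finset (Finset ℕ × ℕ)} {E : Finset ℕ} :
    E ∈ critical m P k ↔ E ⊆ range m ∧ (insert m E, k) ∈ P ∧ (E, k + 1) ∉ P := by
  simp [critical]

lemma exists_partner {d m k : ℕ} {P : Finset (Finset ℕ × ℕ)} (hP : Good d (m + 1) P)
    (hsat : Saturated d (m + 1) P) (hs : Shifted (m + 1) P) (hk : 2 * k + m = 2 * d)
    {E : Finset ℕ} (hE : E ∈ critical m P k) :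
    ∃ D ∈ critical m P k, E ∪ D = range m := by
  obtain ⟨hEm, hEP, hEn⟩ := mem_critical.1 hE
  have hmr : range m ⊆ range (m + 1) := range_subset_range.2 (by omega)
  have hm : m ∉ E := fun h => by simpa using hEm h
  have hsize := (hP.1 _ hEP).2
  dsimp only at hsize
  rw [card_insert_of_notMem hm] at hsize
  by_contra! hcon
  refine hEn (hsat E (k + 1) (hEm.trans hmr) (by omega) ?_ ?_)
  · have h1 := hP.card_union_le hEm hEm hEP hEP
    have h2 := hcon E hE
    by_contra h3
    exact h2 (hP.union_eq_range hs hEm hEm hEP hEP (by rw [union_self]; omega))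
  · rintro ⟨D, r⟩ hD
    dsimp only
    by_contra h
    have hDm := (hP.1 _ hD).1
    dsimp only at hDm
    have hu := hP.2 _ hEP _ hD
    dsimp only at hu
    by_cases hmD : m ∈ D
    · have hD'm := erase_subset_range hDm
      rw [← insert_erase hmD] at hu hD h
      generalize D.erase m = D' at *
      rw [card_union_insert_insert hEm hD'm] at hu
      rw [card_union_insert_right hEm hD'm] at h
      have hDe := hP.union_eq_range hs hEm hD'm hEP hD (by omega)
      rw [hDe, card_range] at h hu
      obtain rfl : r = k := by omega
      refine hcon D' (mem_critical.2 ⟨hD'm, hD, fun hn => ?_⟩) hDe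
      have := hP.2 _ hn _ hEP
      dsimp only at this
      rw [card_union_insert_right hD'm hEm, union_comm, hDe, card_range] at this
      omega
    · have hD'm := erase_subset_range hDm
      rw [erase_eq_of_notMem hmD] at hD'm
      rw [union_comm, card_union_insert_right hD'm hEm, union_comm] at hu
      omega

lemma erase_mem_critical {d m k : ℕ} {P : Finset (Finset ℕ × ℕ)} (hP : Good d (m + 1) P)
    (hsat : Saturated d (m + 1) P) (hk : 2 * k + m = 2 * d) {E D : Finset ℕ}
    (hE : E ∈ critical m P k) (hD : D ∈ critical m P k) (hED : E ∪ D = range m)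
    (hcard : d + 2 ≤ #E + k) {x : ℕ} (hx : x ∈ E ∩ D) : E.erase x ∈ critical m P k := by
  obtain ⟨hEm, hEP, hEn⟩ := mem_critical.1 hE
  obtain ⟨hDm, hDP, hDn⟩ := mem_critical.1 hD
  obtain ⟨hxE, hxD⟩ := mem_inter.1 hx
  have hm : m ∉ E := fun h => by simpa using hEm h
  have hsub : insert m (E.erase x) ⊆ insert m E := insert_subset_insert _ (erase_subset _ _)
  have hEx : E.erase x ⊆ range m := (erase_subset _ _).trans hEm
  refine mem_critical.2 ⟨hEx, hsat _ _ (hsub.trans (hP.1 _ hEP).1) ?_ ?_ ?_, fun hn => ?_⟩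
  · rw [card_insert_of_notMem (by simp [hm]), card_erase_add_one hxE]
    exact hcard
  · have := hP.2 _ hEP _ hEP
    rw [union_self] at this
    have := card_le_card hsub
    dsimp only at *
    omega
  · intro b hb
    have := hP.2 _ hEP _ hb
    have := card_le_card (union_subset_union_left (t := b.1) hsub)
    dsimp only at *
    omega
  · have := hP.2 _ hn _ hDP
    have e : E.erase x ∪ D = range m := by
      rw [← hED]
      ext y
      simp only [mem_union, mem_erase]
      by_cases hy : y = x
      · subst hy; simp [hxD]
      · simp [hy]
    dsimp only at this
    rw [card_union_insert_right hEx hDm, e, card_range] at this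
    omega

lemma exists_critical_selection {n d m : ℕ} (hd : 0 < d) (hn : 9 * d ≤ n) (hm : 3 ≤ m)
    (hmn : m + 1 ≤ n) {P : Finset (Finset ℕ × ℕ)} (hP : Good d (m + 1) P)
    (hsat : Saturated d (m + 1) P) (hs : Shifted (m + 1) P) :
    ∃ T : ℕ → Finset (Finset ℕ), (∀ k, T k ⊆ critical m P k) ∧
      (∀ k l, k + l + m = 2 * d → ∀ E ∈ T k, ∀ D ∈ T l, E ∪ D ≠ range m) ∧
      ∑ k ∈ range (2 * d + 2), #(critical m P k) * (n - m - 1).choose k ≤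
        ∑ k ∈ range (2 * d + 2),
          #(T k) * ((n - m - 1).choose k + (n - m - 1).choose (k + 1)) := by
  have htriv : ∀ k, #(critical m P k) * (n - m - 1).choose k ≤
      #(critical m P k) * ((n - m - 1).choose k + (n - m - 1).choose (k + 1)) :=
    fun k => Nat.mul_le_mul_left _ (Nat.le_add_right _ _)
  rcases lt_or_ge (2 * d) m with hmd | hmd
  · exact ⟨critical m P, fun k => Subset.rfl, fun k l h => by omega,
      sum_le_sum fun k _ => htriv k⟩
  obtain ⟨T, hT, hTe, hTc, hTw⟩ := exists_selection (critical m P) (n - m - 1) (2 * d - m)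
    (range m) (fun k hk => Nat.choose_le_succ_of_lt_half_left (by omega)) (by
      intro k hk
      obtain ⟨h, rfl⟩ : ∃ h, m = 2 * h := ⟨d - k, by omega⟩
      obtain ⟨x, hx, hxc⟩ := exists_le_nine_mul_card_filter_notMem (h := h) (by omega)
        (critical (2 * h) P k) (by
          intro E hE
          obtain ⟨hEm, hEP, -⟩ := mem_critical.1 hE
          have hm : 2 * h ∉ E := fun h => by simpa using hEm h
          have := (hP.1 _ hEP).2
          dsimp only at this
          rw [card_insert_of_notMem hm] at this
          exact ⟨hEm, by omega⟩) (by
          intro E hE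
          obtain ⟨D, hD, hED⟩ := exists_partner hP hsat hs (by omega) hE
          exact ⟨D, hD, hED, fun hc x hx =>
            erase_mem_critical hP hsat (by omega) hE hD hED (by omega) hx⟩)
      refine ⟨{E ∈ critical (2 * h) P k | x ∉ E}, filter_subset _ _, ?_, ?_⟩
      · intro E hE D hD he
        rw [← he, mem_union] at hx
        exact hx.elim (mem_filter.1 hE).2 (mem_filter.1 hD).2
      · have h1 : 8 * (n - 2 * h - 1).choose k ≤ (n - 2 * h - 1).choose (k + 1) := by
          refine Nat.le_of_mul_le_mul_right ?_ (Nat.succ_pos k)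
          have h2 := Nat.choose_succ_right_eq (n - 2 * h - 1) k
          rw [Nat.succ_eq_add_one, h2, mul_comm 8, mul_assoc]
          exact Nat.mul_le_mul_left _ (by omega)
        calc _ ≤ 9 * #{E ∈ critical (2 * h) P k | x ∉ E} * (n - 2 * h - 1).choose k :=
              Nat.mul_le_mul_right _ hxc
          _ = #{E ∈ critical (2 * h) P k | x ∉ E} *
                ((n - 2 * h - 1).choose k + 8 * (n - 2 * h - 1).choose k) := by ring
          _ ≤ _ := by gcongr)
  refine ⟨T, hT, fun k l h => hTc k l (by omega), ?_⟩
  have hle : 2 * d - m + 1 ≤ 2 * d + 2 := by omega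
  rw [← sum_range_add_sum_Ico _ hle, ← sum_range_add_sum_Ico _ hle]
  refine add_le_add hTw (sum_le_sum fun k hk => ?_)
  rw [hTe k (by have := (mem_Ico.1 hk).1; omega)]
  exact htriv k

lemma Good.exists_pred {n d m : ℕ} (hd : 0 < d) (hn : 9 * d ≤ n) (hm : 3 ≤ m) (hmn : m + 1 ≤ n)
    {P : Finset (Finset ℕ × ℕ)} (hP : Good d (m + 1) P) :
    ∃ Q, Good d m Q ∧ ∑ a ∈ P, (n - (m + 1)).choose a.2 ≤ ∑ a ∈ Q, (n - m).choose a.2 := by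
  classical
  obtain ⟨P', hP', hsat, hs, hw⟩ := hP.exists_saturated fun q => (n - (m + 1)).choose q
  obtain ⟨T, hT, hTc, hTw⟩ := exists_critical_selection hd hn hm hmn hP' hsat hs
  have hTm : ∀ k, ∀ E ∈ T k, E ⊆ range m ∧ (insert m E, k) ∈ P' ∧ (E, k + 1) ∉ P' :=
    fun k E hE => mem_critical.1 (hT k hE)
  set N := n - m - 1 with hN
  have hN1 : n - m = N + 1 := by omega
  have hN2 : n - (m + 1) = N := by omega
  rw [hN2] at hw ⊢
  rw [hN1]
  let Q : Finset (Finset ℕ × ℕ) := {a ∈ (range m).powerset ×ˢ range (2 * d + 2 + 1) |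
    a ∈ P' ∨ ∃ k, a.2 = k + 1 ∧ a.1 ∈ T k}
  have hmem : ∀ a ∈ Q, a.1 ⊆ range m ∧ (a ∈ P' ∨ ∃ k, a.2 = k + 1 ∧ a.1 ∈ T k) := by
    intro a ha
    simp only [Q, mem_filter, mem_product, mem_powerset] at ha
    exact ⟨ha.1.1, ha.2⟩
  have hmix : ∀ a b : Finset ℕ × ℕ, a.1 ⊆ range m → a ∈ P' → ∀ k, b.2 = k + 1 → b.1 ∈ T k →
      #(a.1 ∪ b.1) + a.2 + b.2 ≤ 2 * d + 1 := by
    intro a b ham ha k hk hb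
    obtain ⟨h1, h2, -⟩ := hTm k _ hb
    have := hP'.2 _ ha _ h2
    dsimp only at this
    rw [card_union_insert_right ham h1] at this
    omega
  refine ⟨Q, ⟨?_, ?_⟩, hw.trans ?_⟩
  · intro a ha
    obtain ⟨h1, h2⟩ := hmem a ha
    refine ⟨h1, ?_⟩
    rcases h2 with h2 | ⟨k, hk, h2⟩
    · exact (hP'.1 a h2).2
    · obtain ⟨-, h3, -⟩ := hTm k _ h2
      have := (hP'.1 _ h3).2
      have := card_insert_le m a.1
      dsimp only at *
      omega
  · intro a ha b hb
    obtain ⟨ham, ha⟩ := hmem a ha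
    obtain ⟨hbm, hb⟩ := hmem b hb
    rcases ha with ha | ⟨k, hk, ha⟩
    · rcases hb with hb | ⟨l, hl, hb⟩
      · exact hP'.2 a ha b hb
      · exact hmix a b ham ha l hl hb
    · rcases hb with hb | ⟨l, hl, hb⟩
      · have := hmix b a hbm hb k hk ha
        rw [union_comm]
        omega
      · obtain ⟨-, ha', -⟩ := hTm k _ ha
        obtain ⟨-, hb', -⟩ := hTm l _ hb
        have h1 := hP'.card_union_le ham hbm ha' hb'
        by_contra h2
        have h3 := hP'.union_eq_range hs ham hbm ha' hb' (by omega)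
        rw [h3, card_range] at h1 h2
        exact hTc k l (by omega) _ ha _ hb h3
  · rw [sum_snd_eq_sum_fiber hP'.subset_product (N.choose ·),
      sum_snd_eq_sum_fiber (filter_subset _ _ : Q ⊆ _) ((N + 1).choose ·),
      sum_range_succ' _ (2 * d + 2)]
    set a : ℕ → ℕ := fun k => #{E ∈ (range m).powerset | (E, k) ∈ P'} with ha
    have hfib : ∀ k ∈ range (2 * d + 2), #{E ∈ (range (m + 1)).powerset | (E, k) ∈ P'} ≤
        a k + a (k + 1) + #(critical m P' k) := by
      intro k _
      have hsub : {E ∈ (range (m + 1)).powerset | (E, k) ∈ P'} ⊆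
          ({E ∈ (range m).powerset | (E, k) ∈ P'} ∪
          (({E ∈ (range m).powerset | (E, k + 1) ∈ P'} ∪ critical m P' k).image (insert m))) := by
        intro E hE
        simp only [mem_filter, mem_powerset] at hE
        have hEm := erase_subset_range hE.1
        by_cases hmE : m ∈ E
        · refine mem_union_right _ (mem_image.2 ⟨E.erase m, ?_, insert_erase hmE⟩)
          by_cases h : (E.erase m, k + 1) ∈ P'
          · exact mem_union_left _ (by simpa using ⟨hEm, h⟩)
          · exact mem_union_right _ (mem_critical.2 ⟨hEm, by rw [insert_erase hmE]; exact hE.2, h⟩)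
        · rw [erase_eq_of_notMem hmE] at hEm
          exact mem_union_left _ (by simpa using ⟨hEm, hE.2⟩)
      refine (card_le_card hsub).trans ((Finset.card_union_le _ _).trans ?_)
      rw [add_assoc]
      exact Nat.add_le_add_left (card_image_le.trans (Finset.card_union_le _ _)) _
    have hfibQ : ∀ k ∈ range (2 * d + 2), a (k + 1) + #(T k) ≤
        #{E ∈ (range m).powerset | (E, k + 1) ∈ Q} := by
      intro k hk
      have hk : k < 2 * d + 2 := mem_range.1 hk
      rw [ha, ← card_union_of_disjoint]
      · refine card_le_card fun E hE => ?_
        simp only [mem_union, mem_filter, mem_powerset] at hE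
        simp only [Q, mem_filter, mem_product, mem_powerset, mem_range]
        rcases hE with hE | hE
        · exact ⟨hE.1, ⟨hE.1, by omega⟩, Or.inl hE.2⟩
        · exact ⟨(hTm k E hE).1, ⟨(hTm k E hE).1, by omega⟩, Or.inr ⟨k, rfl, hE⟩⟩
      · rw [disjoint_left]
        intro E hE hE'
        exact (hTm k E hE').2.2 (mem_filter.1 hE).2
    have hfib0 : a 0 ≤ #{E ∈ (range m).powerset | (E, 0) ∈ Q} := by
      refine card_le_card fun E hE => ?_
      simp only [mem_filter, mem_powerset] at hE
      simp only [Q, mem_filter, mem_product, mem_powerset, mem_range]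
      exact ⟨hE.1, ⟨hE.1, by omega⟩, Or.inl hE.2⟩
    have h1 : ∑ k ∈ range (2 * d + 2), a k * N.choose k ≤
        ∑ k ∈ range (2 * d + 2), a (k + 1) * N.choose (k + 1) + a 0 := by
      have := sum_range_succ' (fun k => a k * N.choose k) (2 * d + 2)
      rw [sum_range_succ] at this
      simp only [Nat.choose_zero_right, mul_one] at this
      omega
    calc _ ≤ ∑ k ∈ range (2 * d + 2), (a k + a (k + 1) + #(critical m P' k)) * N.choose k :=
          sum_le_sum fun k hk => Nat.mul_le_mul_right _ (hfib k hk)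
      _ = ∑ k ∈ range (2 * d + 2), a k * N.choose k +
          ∑ k ∈ range (2 * d + 2), a (k + 1) * N.choose k +
          ∑ k ∈ range (2 * d + 2), #(critical m P' k) * N.choose k := by
        simp only [add_mul, sum_add_distrib]
      _ ≤ (∑ k ∈ range (2 * d + 2), a (k + 1) * N.choose (k + 1) + a 0) +
          ∑ k ∈ range (2 * d + 2), a (k + 1) * N.choose k +
          ∑ k ∈ range (2 * d + 2), #(T k) * (N.choose k + N.choose (k + 1)) := by
        gcongr
      _ = ∑ k ∈ range (2 * d + 2), (a (k + 1) + #(T k)) * (N + 1).choose (k + 1) + a 0 := by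
        simp only [Nat.choose_succ_succ', add_mul, mul_add, sum_add_distrib]
        ring
      _ ≤ _ := by
        refine add_le_add (sum_le_sum fun k hk => Nat.mul_le_mul_right _ (hfibQ k hk)) ?_
        rw [Nat.choose_zero_right, mul_one]
        exact hfib0

theorem Good.sum_choose_le {n d m : ℕ} (hd : 0 < d) (hn : 9 * d ≤ n) (hm : 3 ≤ m) (hmn : m ≤ n)
    {P : Finset (Finset ℕ × ℕ)} (hP : Good d m P) :
    ∑ a ∈ P, (n - m).choose a.2 ≤ (n - 3).choose (d - 1) := by
  induction m, hm using Nat.le_induction generalizing P with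
  | base =>
    have hsub : P ⊆ {(range 3, d - 1)} := by
      intro a ha
      obtain ⟨h1, h2⟩ := hP.1 a ha
      have h3 := hP.2 a ha a ha
      rw [union_self] at h3
      have h4 := card_le_card h1
      rw [card_range] at h4
      have h5 : a.1 = range 3 := eq_of_subset_of_card_le h1 (by rw [card_range]; omega)
      rw [mem_singleton]
      exact Prod.ext h5 (by dsimp only; omega)
    exact (sum_le_sum_of_subset hsub).trans (by simp)
  | succ m hm ih =>
    obtain ⟨Q, hQ, hw⟩ := hP.exists_pred hd hn hm hmn
    exact hw.trans (ih (by omega) hQ)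

end UnionBounded

theorem stmt_16 (n d : ℕ) (hd : 0 < d) (hn : 9 * d ≤ n)
    (F : ℕ → Finset (Finset (Fin n)))
    (huniform : ∀ i ∈ Finset.Icc 1 d, F i ⊆ Finset.univ.powersetCard (d + 1 + i))
    (hcross : ∀ i ∈ Finset.Icc 1 d, ∀ j ∈ Finset.Icc 1 d,
      ∀ A ∈ F i, ∀ B ∈ F j, i + j + 1 ≤ (A ∩ B).card) :
    ∑ i ∈ Finset.Icc 1 d, (F i).card ≤ (n - 3).choose (d - 1) := by
  classical
  have hmem : ∀ i ∈ Finset.Icc 1 d, ∀ A ∈ F i, A.card = d + 1 + i := fun i hi A hA =>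
    (Finset.mem_powersetCard.1 (huniform i hi hA)).2
  have hdisj : Set.PairwiseDisjoint (Finset.Icc 1 d : Set ℕ) F := by
    intro i hi j hj hij
    refine Finset.disjoint_left.2 fun A hA hA' => hij ?_
    have h1 := hmem i hi A hA
    have h2 := hmem j hj A hA'
    omega
  let g : Finset (Fin n) → Finset ℕ × ℕ := fun A => (A.map Fin.valEmbedding, 0)
  have hg : Function.Injective g := fun A B h =>
    Finset.map_injective Fin.valEmbedding (Prod.ext_iff.1 h).1
  have hgood : UnionBounded.Good d n (((Finset.Icc 1 d).biUnion F).image g) := by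
    constructor
    · simp only [Finset.mem_image, Finset.mem_biUnion]
      rintro _ ⟨A, ⟨i, hi, hA⟩, rfl⟩
      refine ⟨fun x hx => ?_, ?_⟩
      · obtain ⟨y, -, rfl⟩ := Finset.mem_map.1 hx
        exact Finset.mem_range.2 y.2
      · have := hmem i hi A hA
        have := (Finset.mem_Icc.1 hi).1
        simp only [g, Finset.card_map]
        omega
    · simp only [Finset.mem_image, Finset.mem_biUnion]
      rintro _ ⟨A, ⟨i, hi, hA⟩, rfl⟩ _ ⟨B, ⟨j, hj, hB⟩, rfl⟩
      have h1 := hmem i hi A hA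
      have h2 := hmem j hj B hB
      have h3 := hcross i hi j hj A hA B hB
      have h4 := Finset.card_union_add_card_inter A B
      simp only [g, ← Finset.map_union, Finset.card_map]
      omega
  have h := hgood.sum_choose_le hd hn (by omega) le_rfl
  rw [Finset.sum_image hg.injOn] at h
  simp only [g, Nat.choose_zero_right, Finset.sum_const, smul_eq_mul, mul_one] at h
  rwa [Finset.card_biUnion hdisj] at h
end
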